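/- arXiv:2104.09312 — 2 statements merged into one kernel-verified Lean document; each statement's English description precedes it below -/
import Mathlib

section
/- Let G = (V, E) be a finite connected simple graph with edge lengths c(e) > 0, relevant pairs {v_1,u_1}, …, {v_r,u_r} of distinct vertices with weights w_i > 0, and metric closure Ĝ (the complete graph on V with edge lengths d_G(u,v)). Call a vertex terminal if it belongs to some relevant pair, and call an acyclic subgraph in which every relevant pair is connected and every edge lies on the unique path joining some relevant pair an r-forest. Then for every r-forest F of G there exists an acyclic subgraph F̂ of Ĝ in which every relevant pair is connected and which has at most 2r − 2 non-terminal vertices, such that the minimum over linear orderings of the edges of F̂ of the total weighted connection time (computed with the edge lengths of Ĝ) is at most the minimum over linear orderings of the edges of F of the total weighted connection time (computed with the edge lengths of G). Here, for a linear ordering L of an edge set, the connection time of pair i is the sum of the lengths of the edges in the shortest prefix of L whose edges connect v_i and u_i, and the total weighted connection time is Σ_{i=1}^r w_i times these connection times. -/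
/-- The connection time of the vertices `u, v` under the schedule `L` (a list of edges,
each constructed at unit speed, edge `e` taking time `c e`): the total length of the
shortest prefix of `L` whose edges connect `u` and `v`. -/
noncomputable def connTime {V : Type} (c : Sym2 V → ℝ) (L : List (Sym2 V)) (u v : V) : ℝ :=
  ((L.take (sInf {k : ℕ |
      (SimpleGraph.fromEdgeSet {e | e ∈ L.take k}).Reachable u v})).map c).sum

/-- The total weighted connection time `∑ i, w i * t_i(L)` of the relevant pairs
`pair i = (v_i, u_i)` under the schedule `L`. -/
noncomputable def totalCost {V : Type} {r : ℕ} (c : Sym2 V → ℝ) (w : Fin r → ℝ)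
    (pair : Fin r → V × V) (L : List (Sym2 V)) : ℝ :=
  ∑ i : Fin r, w i * connTime c L (pair i).1 (pair i).2

/-- `L` is a linear ordering (schedule) of the edge set `s`: a duplicate-free list whose
elements are exactly the members of `s`. -/
def IsOrdering {α : Type} (L : List α) (s : Set α) : Prop :=
  L.Nodup ∧ ∀ e, e ∈ L ↔ e ∈ s

/-- The length of an edge of the metric closure of `G`: for `e = s(u,v)`, the
shortest-path distance in `G` between `u` and `v`, i.e. the infimum over `u`–`v` walks in
`G` of the total length of their edges. -/
noncomputable def mcLength {V : Type} (G : SimpleGraph V) (c : Sym2 V → ℝ)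
    (e : Sym2 V) : ℝ :=
  sInf {x : ℝ | ∃ u v : V, e = s(u, v) ∧ ∃ p : G.Walk u v, x = (p.edges.map c).sum}



/-- The vertices `u` and `v` are connected by the edges occurring in the list `L`. -/
abbrev ListReachable {V : Type} (L : List (Sym2 V)) (u v : V) : Prop :=
  (SimpleGraph.fromEdgeSet {e | e ∈ L}).Reachable u v

namespace ListReachable

variable {V : Type}

lemma of_mem {L : List (Sym2 V)} {x y : V} (h : s(x, y) ∈ L) : ListReachable L x y := by
  by_cases hxy : x = y
  · exact hxy ▸ SimpleGraph.Reachable.refl x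
  · exact SimpleGraph.Adj.reachable ((SimpleGraph.fromEdgeSet_adj _).2 ⟨h, hxy⟩)

lemma map {L L' : List (Sym2 V)} (φ : V → V)
    (h : ∀ x y, s(x, y) ∈ L → ListReachable L' (φ x) (φ y)) {u v : V}
    (huv : ListReachable L u v) : ListReachable L' (φ u) (φ v) := by
  obtain ⟨p⟩ := huv
  induction p with
  | nil => exact SimpleGraph.Reachable.refl _
  | cons hadj _ ih => exact (h _ _ ((SimpleGraph.fromEdgeSet_adj _).1 hadj).1).trans ih

lemma mono {L L' : List (Sym2 V)} (h : L ⊆ L') {u v : V} (huv : ListReachable L u v) :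
    ListReachable L' u v :=
  huv.map id fun _ _ hxy => of_mem (h hxy)

/-- Appending the edge `s(x, y)` to `A` only joins the classes of `x` and `y`. -/
lemma of_append_singleton {A : List (Sym2 V)} {x y u v : V}
    (h : ListReachable (A ++ [s(x, y)]) u v) :
    ListReachable A u v ∨ (ListReachable A u x ∧ ListReachable A v y) ∨
      (ListReachable A u y ∧ ListReachable A v x) := by
  obtain ⟨p⟩ := h
  induction p with
  | nil => exact Or.inl (SimpleGraph.Reachable.refl _)
  | @cons a b c hadj _ ih =>
    have hmem := ((SimpleGraph.fromEdgeSet_adj _).1 hadj).1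
    simp only [Set.mem_ofPred_eq, List.mem_append, List.mem_singleton] at hmem
    rcases hmem with hmem | hmem
    · have hab := of_mem hmem
      rcases ih with ih | ⟨h1, h2⟩ | ⟨h1, h2⟩
      · exact Or.inl (hab.trans ih)
      · exact Or.inr (Or.inl ⟨hab.trans h1, h2⟩)
      · exact Or.inr (Or.inr ⟨hab.trans h1, h2⟩)
    · rcases Sym2.eq_iff.1 hmem with ⟨rfl, rfl⟩ | ⟨rfl, rfl⟩
      · rcases ih with ih | ⟨_, h2⟩ | ⟨_, h2⟩
        · exact Or.inr (Or.inl ⟨SimpleGraph.Reachable.refl _, ih.symm⟩)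
        · exact Or.inr (Or.inl ⟨SimpleGraph.Reachable.refl _, h2⟩)
        · exact Or.inl h2.symm
      · rcases ih with ih | ⟨_, h2⟩ | ⟨_, h2⟩
        · exact Or.inr (Or.inr ⟨SimpleGraph.Reachable.refl _, ih.symm⟩)
        · exact Or.inl h2.symm
        · exact Or.inr (Or.inr ⟨SimpleGraph.Reachable.refl _, h2⟩)

end ListReachable

section ConnTime

variable {V : Type} {d : Sym2 V → ℝ}

lemma connTime_le (hd : ∀ e, 0 ≤ d e) {P L : List (Sym2 V)} (hP : P <+: L) {u v : V}
    (h : ListReachable P u v) : connTime d L u v ≤ (P.map d).sum := by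
  have hP' := List.prefix_iff_eq_take.1 hP
  have hk : sInf {k : ℕ | ListReachable (L.take k) u v} ≤ P.length :=
    Nat.sInf_le (by rw [Set.mem_ofPred_eq, ← hP']; exact h)
  rw [hP']
  refine List.Sublist.sum_le_sum (((List.take_prefix_take_left hk).sublist).map d) ?_
  intro a ha
  obtain ⟨e, _, rfl⟩ := List.mem_map.1 ha
  exact hd e

lemma exists_prefix_connTime_eq {L : List (Sym2 V)} {u v : V} (h : ListReachable L u v) :
    ∃ P, P <+: L ∧ ListReachable P u v ∧ connTime d L u v = (P.map d).sum := by
  have hmem : sInf {k : ℕ | ListReachable (L.take k) u v} ∈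
      {k : ℕ | ListReachable (L.take k) u v} :=
    Nat.sInf_mem ⟨L.length, by rw [Set.mem_ofPred_eq, List.take_length]; exact h⟩
  exact ⟨_, ⟨_, List.take_append_drop _ L⟩, hmem, rfl⟩

lemma connTime_nonneg (hd : ∀ e, 0 ≤ d e) (L : List (Sym2 V)) (u v : V) :
    0 ≤ connTime d L u v := by
  refine List.sum_nonneg fun a ha => ?_
  obtain ⟨e, _, rfl⟩ := List.mem_map.1 ha
  exact hd e

lemma connTime_mono {c : Sym2 V → ℝ} {L : List (Sym2 V)} (h : ∀ e ∈ L, d e ≤ c e) (u v : V) :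
    connTime d L u v ≤ connTime c L u v :=
  List.sum_le_sum fun e he => h e (List.mem_of_mem_take he)

end ConnTime

/-- `L'` is at least as good a schedule as `L` for the pairs of vertices in `T`: every prefix
of `L` is matched by a prefix of `L'` that is no longer and connects at least the same pairs. -/
def Dominates {V : Type} (d : Sym2 V → ℝ) (T : Set V) (L' L : List (Sym2 V)) : Prop :=
  ∀ P, P <+: L → ∃ P', P' <+: L' ∧ (P'.map d).sum ≤ (P.map d).sum ∧
    ∀ u ∈ T, ∀ v ∈ T, ListReachable P u v → ListReachable P' u v

namespace Dominates

variable {V : Type} {d : Sym2 V → ℝ} {T : Set V}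

lemma refl (L : List (Sym2 V)) : Dominates d T L L :=
  fun P hP => ⟨P, hP, le_rfl, fun _ _ _ _ h => h⟩

lemma trans {L₁ L₂ L₃ : List (Sym2 V)} (h₁ : Dominates d T L₁ L₂) (h₂ : Dominates d T L₂ L₃) :
    Dominates d T L₁ L₃ := by
  intro P hP
  obtain ⟨Q, hQ, hs, hr⟩ := h₂ P hP
  obtain ⟨R, hR, hs', hr'⟩ := h₁ Q hQ
  exact ⟨R, hR, hs'.trans hs, fun u hu v hv h => hr' u hu v hv (hr u hu v hv h)⟩

lemma listReachable {L' L : List (Sym2 V)} (h : Dominates d T L' L) {u v : V} (hu : u ∈ T)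
    (hv : v ∈ T) (huv : ListReachable L u v) : ListReachable L' u v := by
  obtain ⟨P, hP, _, hr⟩ := h L List.prefix_rfl
  exact (hr u hu v hv huv).mono hP.subset

lemma connTime_le {L' L : List (Sym2 V)} (h : Dominates d T L' L) (hd : ∀ e, 0 ≤ d e) {u v : V}
    (hu : u ∈ T) (hv : v ∈ T) (huv : ListReachable L u v) :
    connTime d L' u v ≤ connTime d L u v := by
  obtain ⟨P, hP, hPr, hPe⟩ := exists_prefix_connTime_eq (d := d) huv
  obtain ⟨P', hP', hs, hr⟩ := h P hP
  rw [hPe]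
  exact (_root_.connTime_le hd hP' (hr u hu v hv hPr)).trans hs

end Dominates

lemma List.prefix_append_cons_iff {α : Type*} {P A B : List α} {e : α} :
    P <+: A ++ e :: B ↔ P <+: A ∨ ∃ Q, Q <+: B ∧ P = A ++ e :: Q := by
  constructor
  · intro h
    have hA := List.prefix_append A (e :: B)
    rcases (Nat.le_total P.length A.length).imp (List.prefix_of_prefix_length_le h hA)
      (List.prefix_of_prefix_length_le hA h) with h' | ⟨Q, rfl⟩
    · exact Or.inl h'
    · rw [List.prefix_append_right_inj, List.prefix_cons_iff] at h
      rcases h with rfl | ⟨Q, rfl, hQ⟩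
      · exact Or.inl (by simp)
      · exact Or.inr ⟨Q, hQ, rfl⟩
  · rintro (h | ⟨Q, hQ, rfl⟩)
    · exact h.trans (List.prefix_append _ _)
    · rw [List.prefix_append_right_inj, List.prefix_cons_inj]
      exact hQ

section Reduction

variable {V : Type} {d : Sym2 V → ℝ} {T : Set V}

/-- Deleting an edge that a retraction fixing `T` contracts. -/
lemma dominates_delete (hd : ∀ e, 0 ≤ d e) {A B : List (Sym2 V)} {e : Sym2 V} (φ : V → V)
    (hφT : ∀ u ∈ T, φ u = u)
    (hφ : ∀ x y, s(x, y) ∈ A ++ B → φ x = x ∧ φ y = y)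
    (hφe : ∀ x y, s(x, y) = e → ListReachable A (φ x) (φ y)) :
    Dominates d T (A ++ B) (A ++ e :: B) := by
  intro P hP
  rcases List.prefix_append_cons_iff.1 hP with hP | ⟨Q, hQ, rfl⟩
  · exact ⟨P, hP.trans (List.prefix_append _ _), le_rfl, fun _ _ _ _ h => h⟩
  · refine ⟨A ++ Q, (List.prefix_append_right_inj A).2 hQ, ?_, fun u hu v hv h => ?_⟩
    · simp only [List.map_append, List.map_cons, List.sum_append, List.sum_cons]
      linarith [hd e]
    · rw [← hφT u hu, ← hφT v hv]
      refine h.map φ fun x y hxy => ?_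
      have hcases : s(x, y) = e ∨ s(x, y) ∈ A ++ Q := by
        simp only [List.mem_append, List.mem_cons] at hxy ⊢
        tauto
      rcases hcases with hxy | hxy
      · exact (hφe x y hxy).mono (List.subset_append_left _ _)
      · obtain ⟨hx, hy⟩ := hφ x y
          (((List.prefix_append_right_inj A).2 hQ).subset hxy)
        rw [hx, hy]
        exact ListReachable.of_mem hxy

/-- Deleting the only edge at a vertex outside `T`. -/
lemma dominates_delete_leaf [DecidableEq V] (hd : ∀ e, 0 ≤ d e) {A B : List (Sym2 V)} {v a : V}
    (hv : v ∉ T) (hA : ∀ e ∈ A, v ∉ e) (hB : ∀ e ∈ B, v ∉ e) :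
    Dominates d T (A ++ B) (A ++ s(v, a) :: B) := by
  refine dominates_delete hd (fun x => if x = v then a else x) ?_ ?_ ?_
  · intro u hu
    exact if_neg fun h : u = v => hv (h ▸ hu)
  · intro x y hxy
    have hvn : v ∉ s(x, y) := (List.mem_append.1 hxy).elim (hA _) (hB _)
    rw [Sym2.mem_iff, not_or] at hvn
    exact ⟨if_neg (Ne.symm hvn.1), if_neg (Ne.symm hvn.2)⟩
  · intro x y hxy
    have heq : (if x = v then a else x) = (if y = v then a else y) := by
      rcases Sym2.eq_iff.1 hxy with ⟨rfl, rfl⟩ | ⟨rfl, rfl⟩ <;> simp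
    simp only [heq]
    exact SimpleGraph.Reachable.refl _

/-- Replacing the only two edges at a vertex outside `T` by a single shortcut edge. -/
lemma dominates_shortcut [DecidableEq V] (hd : ∀ e, 0 ≤ d e) {A B C : List (Sym2 V)} {v a b : V}
    (htri : d s(a, b) ≤ d s(v, a) + d s(v, b)) (hv : v ∉ T)
    (hA : ∀ e ∈ A, v ∉ e) (hB : ∀ e ∈ B, v ∉ e) (hC : ∀ e ∈ C, v ∉ e) :
    Dominates d T (A ++ B ++ s(a, b) :: C) (A ++ s(v, a) :: (B ++ s(v, b) :: C)) := by
  intro P hP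
  have hassoc : A ++ s(v, a) :: (B ++ s(v, b) :: C) = (A ++ s(v, a) :: B) ++ s(v, b) :: C := by
    simp
  rw [hassoc] at hP
  rcases List.prefix_append_cons_iff.1 hP with hP | ⟨Q, hQ, rfl⟩
  · obtain ⟨P', hP', h⟩ := dominates_delete_leaf hd hv hA hB (a := a) P hP
    exact ⟨P', hP'.trans (List.prefix_append _ _), h⟩
  · refine ⟨A ++ B ++ s(a, b) :: Q,
      (List.prefix_append_right_inj _).2 ((List.prefix_cons_inj _).2 hQ), ?_,
      fun u hu w hw h => ?_⟩
    · simp only [List.map_append, List.map_cons, List.sum_append, List.sum_cons]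
      linarith
    · have hT : ∀ u ∈ T, (if u = v then a else u) = u := fun u hu =>
        if_neg fun h : u = v => hv (h ▸ hu)
      rw [← hT u hu, ← hT w hw]
      have hab : ListReachable (A ++ B ++ s(a, b) :: Q) a b := ListReachable.of_mem (by simp)
      refine h.map (fun x => if x = v then a else x) fun x y hxy => ?_
      have hcases : s(x, y) = s(v, a) ∨ s(x, y) = s(v, b) ∨
          (v ∉ s(x, y) ∧ s(x, y) ∈ A ++ B ++ s(a, b) :: Q) := by
        simp only [List.mem_append, List.mem_cons] at hxy ⊢
        rcases hxy with (hxy | hxy | hxy) | hxy | hxy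
        · exact Or.inr (Or.inr ⟨hA _ hxy, by tauto⟩)
        · exact Or.inl hxy
        · exact Or.inr (Or.inr ⟨hB _ hxy, by tauto⟩)
        · exact Or.inr (Or.inl hxy)
        · exact Or.inr (Or.inr ⟨hC _ (hQ.subset hxy), by tauto⟩)
      rcases hcases with hxy | hxy | ⟨hvn, hxy⟩
      · have heq : (if x = v then a else x) = (if y = v then a else y) := by
          rcases Sym2.eq_iff.1 hxy with ⟨rfl, rfl⟩ | ⟨rfl, rfl⟩ <;> simp
        simp only [heq]
        exact SimpleGraph.Reachable.refl _
      · by_cases hbv : b = v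
        · have heq : (if x = v then a else x) = (if y = v then a else y) := by
            rcases Sym2.eq_iff.1 hxy with ⟨rfl, rfl⟩ | ⟨rfl, rfl⟩ <;> simp [hbv]
          simp only [heq]
          exact SimpleGraph.Reachable.refl _
        · rcases Sym2.eq_iff.1 hxy with ⟨rfl, rfl⟩ | ⟨rfl, rfl⟩
          · simp only [if_neg hbv, if_true]
            exact hab
          · simp only [if_neg hbv, if_true]
            exact hab.symm
      · rw [Sym2.mem_iff, not_or] at hvn
        simp only [if_neg (Ne.symm hvn.1), if_neg (Ne.symm hvn.2)]
        exact ListReachable.of_mem hxy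

/-- No edge of `L` joins two vertices already connected by the preceding edges. -/
def Irredundant (L : List (Sym2 V)) : Prop :=
  ∀ A B x y, L = A ++ s(x, y) :: B → ¬ ListReachable A x y

/-- Every schedule is dominated by an irredundant one in which no vertex outside `T` has
degree `1` or `2`. -/
theorem exists_dominates_irredundant [DecidableEq V] (hd : ∀ e, 0 ≤ d e)
    (htri : ∀ v a b, d s(a, b) ≤ d s(v, a) + d s(v, b)) (L : List (Sym2 V)) :
    ∃ L', Dominates d T L' L ∧ Irredundant L' ∧
      ∀ v ∉ T, (∃ e ∈ L', v ∈ e) → 3 ≤ L'.countP (v ∈ ·) := by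
  induction hn : L.length using Nat.strong_induction_on generalizing L with
  | _ n ih =>
  have step : ∀ L₁, L₁.length < n → Dominates d T L₁ L → ∃ L', Dominates d T L' L ∧
      Irredundant L' ∧ ∀ v ∉ T, (∃ e ∈ L', v ∈ e) → 3 ≤ L'.countP (v ∈ ·) := by
    intro L₁ hlen hdom
    obtain ⟨L', h, h'⟩ := ih _ hlen L₁ rfl
    exact ⟨L', h.trans hdom, h'⟩
  by_cases hirr : Irredundant L
  swap
  · unfold Irredundant at hirr
    push Not at hirr
    obtain ⟨A, B, x, y, rfl, hxy⟩ := hirr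
    refine step (A ++ B) (by simp at hn ⊢; omega) ?_
    refine dominates_delete hd id (fun _ _ => rfl) (fun _ _ _ => ⟨rfl, rfl⟩) fun a b hab => ?_
    rcases Sym2.eq_iff.1 hab with ⟨rfl, rfl⟩ | ⟨rfl, rfl⟩
    · exact hxy
    · exact hxy.symm
  by_cases hdeg : ∀ v ∉ T, (∃ e ∈ L, v ∈ e) → 3 ≤ L.countP (v ∈ ·)
  · exact ⟨L, Dominates.refl L, hirr, hdeg⟩
  push Not at hdeg
  obtain ⟨v, hv, ⟨e₀, he₀, hve₀⟩, hlt⟩ := hdeg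
  rw [List.countP_eq_length_filter] at hlt
  match hf : L.filter (v ∈ ·) with
  | [] =>
    rw [List.filter_eq_nil_iff] at hf
    exact absurd hve₀ (by simpa using hf e₀ he₀)
  | [e] =>
    obtain ⟨A, B, rfl, hA, he, hB⟩ := List.filter_eq_cons_iff.1 hf
    rw [List.filter_eq_nil_iff] at hB
    simp only [decide_eq_true_eq] at hA hB he
    obtain ⟨a, rfl⟩ := Sym2.mem_iff_exists.1 he
    exact step (A ++ B) (by simp at hn ⊢; omega) (dominates_delete_leaf hd hv hA hB)
  | [e, f] =>
    obtain ⟨A, B', rfl, hA, he, hf'⟩ := List.filter_eq_cons_iff.1 hf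
    obtain ⟨B, C, rfl, hB, hvf, hC⟩ := List.filter_eq_cons_iff.1 hf'
    rw [List.filter_eq_nil_iff] at hC
    simp only [decide_eq_true_eq] at hA hB hC he hvf
    obtain ⟨a, rfl⟩ := Sym2.mem_iff_exists.1 he
    obtain ⟨b, rfl⟩ := Sym2.mem_iff_exists.1 hvf
    exact step (A ++ B ++ s(a, b) :: C) (by simp at hn ⊢; omega)
      (dominates_shortcut hd (htri v a b) hv hA hB hC)
  | _ :: _ :: _ :: _ =>
    simp only [hf, List.length_cons] at hlt
    omega

end Reduction

namespace Irredundant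

variable {V : Type}

lemma of_append {A B : List (Sym2 V)} (h : Irredundant (A ++ B)) : Irredundant A :=
  fun A' B' x y hA => h A' (B' ++ B) x y (by simp [hA])

lemma not_isDiag {L : List (Sym2 V)} (h : Irredundant L) : ∀ e ∈ L, ¬ e.IsDiag := by
  intro e he hdiag
  obtain ⟨A, B, rfl⟩ := List.append_of_mem he
  induction e with
  | _ x y =>
    rw [Sym2.mk_isDiag_iff] at hdiag
    subst hdiag
    exact h A B x x rfl (SimpleGraph.Reachable.refl _)

lemma nodup {L : List (Sym2 V)} (h : Irredundant L) : L.Nodup := by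
  induction L using List.reverseRecOn with
  | nil => exact List.nodup_nil
  | append_singleton A e ih =>
    rw [← List.concat_eq_append, List.nodup_concat]
    refine ⟨fun he => ?_, ih h.of_append⟩
    induction e with
    | _ x y => exact h A [] x y rfl (ListReachable.of_mem he)

lemma isAcyclic {L : List (Sym2 V)} (h : Irredundant L) :
    (SimpleGraph.fromEdgeSet {e | e ∈ L}).IsAcyclic := by
  induction L using List.reverseRecOn with
  | nil => simp
  | append_singleton A e ih =>
    induction e with
    | _ x y =>
      have heq : SimpleGraph.fromEdgeSet {e | e ∈ A ++ [s(x, y)]} =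
          SimpleGraph.fromEdgeSet {e | e ∈ A} ⊔ SimpleGraph.edge x y := by
        rw [SimpleGraph.edge, ← SimpleGraph.fromEdgeSet_union]
        congr 1
        ext
        simp [or_comm]
      rw [heq, SimpleGraph.isAcyclic_add_edge_iff_of_not_reachable _ _ (h A [] x y rfl)]
      exact ih h.of_append

/-- An irredundant list has at most as many edges as there are vertices outside a given set of
pairwise disconnected vertices. -/
lemma card_add_length_le [Fintype V] [DecidableEq V] {L : List (Sym2 V)} (h : Irredundant L)
    (U : Finset V) (hU : ∀ u ∈ U, ∀ v ∈ U, ListReachable L u v → u = v) :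
    U.card + L.length ≤ Fintype.card V := by
  induction L using List.reverseRecOn generalizing U with
  | nil => simpa using U.card_le_univ
  | append_singleton A e ih =>
    induction e with
    | _ x y =>
      have hxy : ¬ ListReachable A x y := h A [] x y rfl
      have hxy' : ListReachable (A ++ [s(x, y)]) x y := ListReachable.of_mem (by simp)
      have hmono : ∀ {u v}, ListReachable A u v → ListReachable (A ++ [s(x, y)]) u v :=
        fun huv => huv.mono (List.subset_append_left _ _)
      obtain ⟨z, hz⟩ : ∃ z, ∀ u ∈ U, ¬ ListReachable A u z := by
        by_contra! hcon
        obtain ⟨u, hu, hux⟩ := hcon x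
        obtain ⟨v, hv, hvy⟩ := hcon y
        have huv := hU u hu v hv ((hmono hux).trans (hxy'.trans (hmono hvy).symm))
        subst huv
        exact hxy (hux.symm.trans hvy)
      have hzU : z ∉ U := fun hzU => hz z hzU (SimpleGraph.Reachable.refl _)
      have := ih h.of_append (insert z U) fun u hu v hv huv => by
        rw [Finset.mem_insert] at hu hv
        rcases hu with rfl | hu <;> rcases hv with rfl | hv
        · rfl
        · exact absurd huv.symm (hz v hv)
        · exact absurd huv (hz u hu)
        · exact hU u hu v hv (hmono huv)
      rw [Finset.card_insert_of_notMem hzU] at this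
      simp only [List.length_append, List.length_singleton]
      omega

end Irredundant

lemma sum_countP_mem {V : Type} [Fintype V] [DecidableEq V] (L : List (Sym2 V))
    (h : ∀ e ∈ L, ¬ e.IsDiag) : ∑ v, L.countP (v ∈ ·) = 2 * L.length := by
  induction L with
  | nil => simp
  | cons e L ih =>
    have he : ∑ v : V, (if v ∈ e then 1 else 0) = 2 := by
      rw [← Finset.card_filter, ← Sym2.card_toFinset_of_not_isDiag e (h e (by simp))]
      congr 1
      ext
      simp
    simp only [List.countP_cons, decide_eq_true_eq, Finset.sum_add_distrib, he,
      ih fun e he => h e (List.mem_cons_of_mem _ he), List.length_cons]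
    ring

/-- In a forest, the vertices of degree at least `3` are outnumbered by two by any set of
non-isolated vertices containing all others. -/
lemma Irredundant.card_add_two_le {V : Type} [Fintype V] [DecidableEq V] {L : List (Sym2 V)}
    (h : Irredundant L) {T : Finset V} (hT : T.Nonempty) (hTL : ∀ v ∈ T, ∃ e ∈ L, v ∈ e)
    (hdeg : ∀ v ∉ T, (∃ e ∈ L, v ∈ e) → 3 ≤ L.countP (v ∈ ·)) :
    {v : V | (∃ e ∈ L, v ∈ e) ∧ v ∉ T}.ncard + 2 ≤ T.card := by
  classical
  obtain ⟨t, ht⟩ := hT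
  set N : Finset V := {v | (∃ e ∈ L, v ∈ e) ∧ v ∉ T} with hN
  set I : Finset V := {v | ¬ ∃ e ∈ L, v ∈ e} with hI
  have hNcard : {v : V | (∃ e ∈ L, v ∈ e) ∧ v ∉ T}.ncard = N.card := by
    rw [← Set.ncard_coe_finset]
    congr 1
    ext
    simp [hN]
  have hisol : ∀ {u v}, u ∈ I → ListReachable L u v → u = v := by
    rintro u v hu ⟨p⟩
    cases p with
    | nil => rfl
    | cons hadj _ =>
      refine absurd ⟨_, ((SimpleGraph.fromEdgeSet_adj _).1 hadj).1, Sym2.mem_mk_left _ _⟩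
        (Finset.mem_filter.1 hu).2
  have htI : t ∉ I := by simpa [hI] using hTL t ht
  have hcomp := h.card_add_length_le (insert t I) fun u hu v hv huv => by
    rw [Finset.mem_insert] at hu hv
    rcases hu with rfl | hu
    · rcases hv with rfl | hv
      · rfl
      · exact (hisol hv huv.symm).symm
    · exact hisol hu huv
  rw [Finset.card_insert_of_notMem htI] at hcomp
  have hNT : Disjoint N T := Finset.disjoint_left.2 fun v hv => (Finset.mem_filter.1 hv).2.2
  have hNTI : (N ∪ T)ᶜ = I := by
    ext v
    have := hTL v
    simp only [hN, hI, Finset.mem_compl, Finset.mem_union, Finset.mem_filter, Finset.mem_univ,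
      true_and, not_iff_not]
    by_cases hv : v ∈ T <;> simp [hv, this]
  have hcard := Finset.card_compl_add_card (N ∪ T)
  rw [hNTI, Finset.card_union_of_disjoint hNT] at hcard
  have hsum := sum_countP_mem L h.not_isDiag
  have hle : ∑ v ∈ N ∪ T, L.countP (v ∈ ·) ≤ ∑ v, L.countP (v ∈ ·) :=
    Finset.sum_le_sum_of_subset (Finset.subset_univ _)
  rw [Finset.sum_union hNT] at hle
  have hN3 : N.card * 3 ≤ ∑ v ∈ N, L.countP (v ∈ ·) :=
    Finset.card_nsmul_le_sum _ _ _ fun v hv =>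
      hdeg v (Finset.mem_filter.1 hv).2.2 (Finset.mem_filter.1 hv).2.1
  have hT1 : T.card * 1 ≤ ∑ v ∈ T, L.countP (v ∈ ·) :=
    Finset.card_nsmul_le_sum T (fun v => L.countP (v ∈ ·)) 1 fun v hv => by
      obtain ⟨e, he, hve⟩ := hTL v hv
      exact List.countP_pos_iff.2 ⟨e, he, decide_eq_true hve⟩
  omega

section MetricClosure

variable {V : Type} {G : SimpleGraph V} {c : Sym2 V → ℝ}

lemma walk_length_nonneg (hc : ∀ e ∈ G.edgeSet, 0 < c e) {u v : V} (p : G.Walk u v) :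
    0 ≤ (p.edges.map c).sum := by
  refine List.sum_nonneg fun a ha => ?_
  obtain ⟨e, he, rfl⟩ := List.mem_map.1 ha
  exact (hc e (p.edges_subset_edgeSet he)).le

lemma mcLength_nonneg (hc : ∀ e ∈ G.edgeSet, 0 < c e) (e : Sym2 V) : 0 ≤ mcLength G c e := by
  refine Real.sInf_nonneg ?_
  rintro _ ⟨u, v, -, p, rfl⟩
  exact walk_length_nonneg hc p

lemma mcLength_mk (u v : V) :
    mcLength G c s(u, v) = ⨅ p : G.Walk u v, (p.edges.map c).sum := by
  rw [mcLength, iInf]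
  congr 1
  ext x
  simp only [Set.mem_ofPred_eq, Set.mem_range]
  constructor
  · rintro ⟨a, b, hab, p, rfl⟩
    rcases Sym2.eq_iff.1 hab with ⟨rfl, rfl⟩ | ⟨rfl, rfl⟩
    · exact ⟨p, rfl⟩
    · exact ⟨p.reverse, by simp [List.sum_reverse]⟩
  · rintro ⟨p, rfl⟩
    exact ⟨u, v, rfl, p, rfl⟩

lemma mcLength_mk_le (hc : ∀ e ∈ G.edgeSet, 0 < c e) {u v : V} (p : G.Walk u v) :
    mcLength G c s(u, v) ≤ (p.edges.map c).sum := by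
  rw [mcLength_mk]
  exact ciInf_le ⟨0, by rintro _ ⟨q, rfl⟩; exact walk_length_nonneg hc q⟩ p

lemma mcLength_le (hc : ∀ e ∈ G.edgeSet, 0 < c e) {e : Sym2 V} (he : e ∈ G.edgeSet) :
    mcLength G c e ≤ c e := by
  induction e with
  | _ x y => simpa using mcLength_mk_le hc (.cons ((G.mem_edgeSet).1 he) .nil)

lemma mcLength_triangle (hconn : G.Connected) (hc : ∀ e ∈ G.edgeSet, 0 < c e) (v a b : V) :
    mcLength G c s(a, b) ≤ mcLength G c s(v, a) + mcLength G c s(v, b) := by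
  have : Nonempty (G.Walk v a) := hconn.preconnected v a
  have : Nonempty (G.Walk v b) := hconn.preconnected v b
  rw [mcLength_mk v a, mcLength_mk v b]
  refine le_ciInf_add_ciInf fun p q => (mcLength_mk_le hc (p.reverse.append q)).trans_eq ?_
  simp [List.sum_reverse]

end MetricClosure

/-- Lemma 5 / lemR1: for every r-forest `F` of `G` (an acyclic edge set of
`G` connecting every relevant pair, each of whose edges lies on the unique path of some
relevant pair), there is an acyclic edge set `Fh` of the metric closure `Ĝ = ⊤` connecting
every relevant pair, with at most `2r − 2` non-terminal vertices, whose optimal total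
weighted connection time (with the metric-closure lengths) is at most that of `F` (with
the lengths of `G`). -/
theorem stmt10 (V : Type) [Fintype V] [DecidableEq V] (G : SimpleGraph V)
    (hconn : G.Connected) (c : Sym2 V → ℝ) (hc : ∀ e ∈ G.edgeSet, 0 < c e)
    (r : ℕ) (hr : 1 ≤ r)
    (pair : Fin r → V × V) (hpair : ∀ i, (pair i).1 ≠ (pair i).2)
    (w : Fin r → ℝ) (hw : ∀ i, 0 < w i)
    (F : Finset (Sym2 V)) (hFsub : ↑F ⊆ G.edgeSet)
    (hFacyclic : (SimpleGraph.fromEdgeSet (↑F : Set (Sym2 V))).IsAcyclic)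
    (hFconn : ∀ i, (SimpleGraph.fromEdgeSet (↑F : Set (Sym2 V))).Reachable
        (pair i).1 (pair i).2)
    (hFuse : ∀ e ∈ F, ∃ i, ¬ (SimpleGraph.fromEdgeSet (↑(F.erase e) : Set (Sym2 V))).Reachable
        (pair i).1 (pair i).2) :
    ∃ Fh : Finset (Sym2 V),
      ↑Fh ⊆ (⊤ : SimpleGraph V).edgeSet ∧
      (SimpleGraph.fromEdgeSet (↑Fh : Set (Sym2 V))).IsAcyclic ∧
      (∀ i, (SimpleGraph.fromEdgeSet (↑Fh : Set (Sym2 V))).Reachable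
          (pair i).1 (pair i).2) ∧
      {v : V | (∃ e ∈ Fh, v ∈ e) ∧ ¬ ∃ i, v = (pair i).1 ∨ v = (pair i).2}.ncard
        ≤ 2 * r - 2 ∧
      sInf {x : ℝ | ∃ L : List (Sym2 V), IsOrdering L ↑Fh ∧
          x = totalCost (mcLength G c) w pair L}
        ≤ sInf {x : ℝ | ∃ L : List (Sym2 V), IsOrdering L ↑F ∧
            x = totalCost c w pair L} := by
  set d := mcLength G c
  have hd : ∀ e, 0 ≤ d e := mcLength_nonneg hc
  let T : Finset V :=
    Finset.univ.image (fun i => (pair i).1) ∪ Finset.univ.image (fun i => (pair i).2)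
  have hT : ∀ v, v ∈ T ↔ ∃ i, v = (pair i).1 ∨ v = (pair i).2 := by
    intro v
    simp only [T, Finset.mem_union, Finset.mem_image, Finset.mem_univ, true_and]
    grind
  have hTcard : T.card ≤ 2 * r := by
    have h₁ := Finset.card_image_le (s := (Finset.univ : Finset (Fin r))) (f := fun i => (pair i).1)
    have h₂ := Finset.card_image_le (s := (Finset.univ : Finset (Fin r))) (f := fun i => (pair i).2)
    have h₃ : T.card ≤ _ := Finset.card_union_le _ _
    rw [Finset.card_univ, Fintype.card_fin] at h₁ h₂
    omega
  have hT₁ : ∀ i, (pair i).1 ∈ (T : Set V) := fun i => (hT _).2 ⟨i, Or.inl rfl⟩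
  have hT₂ : ∀ i, (pair i).2 ∈ (T : Set V) := fun i => (hT _).2 ⟨i, Or.inr rfl⟩
  -- an optimal schedule of `F`
  obtain ⟨L, ⟨hLnodup, hLF⟩, hLopt⟩ : sInf {x : ℝ | ∃ L : List (Sym2 V), IsOrdering L ↑F ∧
      x = totalCost c w pair L} ∈ {x : ℝ | ∃ L : List (Sym2 V), IsOrdering L ↑F ∧
      x = totalCost c w pair L} := by
    refine Set.Nonempty.csInf_mem
      ⟨_, F.toList, ⟨F.nodup_toList, fun e => by simp⟩, rfl⟩ ?_
    refine ((List.finite_length_eq (Sym2 V) F.card).image (totalCost c w pair)).subset ?_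
    rintro _ ⟨L, ⟨hn, hL⟩, rfl⟩
    refine ⟨L, ?_, rfl⟩
    have : L.toFinset = F := by
      ext e
      simpa using hL e
    rw [Set.mem_ofPred_eq, ← this, List.toFinset_card_of_nodup hn]
  have hLset : {e | e ∈ L} = (↑F : Set (Sym2 V)) := Set.ext hLF
  have hLconn : ∀ i, ListReachable L (pair i).1 (pair i).2 := fun i => by
    rw [ListReachable, hLset]
    exact hFconn i
  obtain ⟨L', hdom, hirr, hdeg⟩ := exists_dominates_irredundant (T := (T : Set V)) hd
    (mcLength_triangle hconn hc) L
  have hL'conn : ∀ i, ListReachable L' (pair i).1 (pair i).2 := fun i =>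
    hdom.listReachable (hT₁ i) (hT₂ i) (hLconn i)
  have hset : (↑L'.toFinset : Set (Sym2 V)) = {e | e ∈ L'} := by
    ext
    simp
  have hsupp : ∀ {u v}, u ≠ v → ListReachable L' u v → ∃ e ∈ L', u ∈ e := by
    rintro u v huv ⟨p⟩
    cases p with
    | nil => exact absurd rfl huv
    | cons hadj _ =>
      exact ⟨_, ((SimpleGraph.fromEdgeSet_adj _).1 hadj).1, Sym2.mem_mk_left _ _⟩
  have hcard := hirr.card_add_two_le (T := T) ⟨_, (hT _).2 ⟨(⟨0, hr⟩ : Fin r), Or.inl rfl⟩⟩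
    (fun v hv => by
      obtain ⟨i, rfl | rfl⟩ := (hT v).1 hv
      · exact hsupp (hpair i) (hL'conn i)
      · exact hsupp (hpair i).symm (hL'conn i).symm)
    (fun v hv => hdeg v (by simpa using hv))
  refine ⟨L'.toFinset, ?_, ?_, ?_, ?_, ?_⟩
  · intro e he
    rw [SimpleGraph.edgeSet_top]
    exact hirr.not_isDiag e (by simpa using he)
  · rw [hset]
    exact hirr.isAcyclic
  · rw [hset]
    exact hL'conn
  · simp only [hT, List.mem_toFinset] at hcard ⊢
    omega
  · rw [hLopt]
    refine le_trans (csInf_le ⟨0, ?_⟩ ⟨L', ⟨hirr.nodup, fun e => by simp⟩, rfl⟩) ?_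
    · rintro _ ⟨M, -, rfl⟩
      exact Finset.sum_nonneg fun i _ => mul_nonneg (hw i).le (connTime_nonneg hd _ _ _)
    · refine Finset.sum_le_sum fun i _ => mul_le_mul_of_nonneg_left ?_ (hw i).le
      exact (hdom.connTime_le hd (hT₁ i) (hT₂ i) (hLconn i)).trans
        (connTime_mono (fun e he => mcLength_le hc (hFsub ((hLF e).1 he))) _ _)
end

section
/- Let T be a finite tree with edge lengths c(e) > 0 and nonnegative weights w({u,v}) on unordered pairs of vertices. For a linear ordering L of the edge set of a subtree T̃ of T, and vertices u, v of T̃, let t_L(u,v) be the sum of c over the shortest prefix of L containing all edges of the unique u–v path in T, and let Z_{T̃}(L) = Σ w({u,v})·t_L(u,v), the sum over all pairs {u,v} of vertices of T̃. Fix an edge e of T and let T′ and T″ be the two components of T with e deleted. Suppose L′ minimizes Z_{T′} over all linear orderings of the edges of T′, and L″ minimizes Z_{T″} over all linear orderings of the edges of T″. Then among the linear orderings of the edge set of T whose last element is e, there is one minimizing Z_T whose restriction to the edges of T′ is L′ and whose restriction to the edges of T″ is L″. -/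
/-- The connection time of the pair `q` of vertices under the schedule `L` (a list of
edges, edge `e` taking time `c e`): the total length of the shortest prefix of `L` whose
edges connect the two vertices of `q`. On a tree this is the total length of the shortest
prefix containing all edges of the unique path joining the pair. -/
noncomputable def pairTime {V : Type} (c : Sym2 V → ℝ) (L : List (Sym2 V))
    (q : Sym2 V) : ℝ :=
  ((L.take (sInf {k : ℕ | ∀ x ∈ q, ∀ y ∈ q,
      (SimpleGraph.fromEdgeSet {e | e ∈ L.take k}).Reachable x y})).map c).sum

open Classical in
/-- The total weighted connection time `Z_{T̃}(L) = ∑_{{u,v} ⊆ A} w {u,v} · t_L(u,v)`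
over all (unordered) pairs of vertices of the subtree with vertex set `A`. -/
noncomputable def treeObj {V : Type} [Fintype V] (c : Sym2 V → ℝ) (w : Sym2 V → ℝ)
    (A : Set V) (L : List (Sym2 V)) : ℝ :=
  ∑ q : Sym2 V, if ∀ x ∈ q, x ∈ A then w q * pairTime c L q else 0

/-- The cost of building the edges of `L` in order, starting from the built set `P`, when `U` of the
built set is paid per unit of time. -/
def scheduleCost {E : Type*} [DecidableEq E] (c : E → ℝ) (U : Finset E → ℝ) :
    Finset E → List E → ℝ
  | _, [] => 0
  | P, f :: L => c f * U P + scheduleCost c U (insert f P) L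

section Schedule

variable {E : Type*} [DecidableEq E] {c : E → ℝ}

theorem scheduleCost_append (U : Finset E → ℝ) (P : Finset E) (L M : List E) :
    scheduleCost c U P (L ++ M) =
      scheduleCost c U P L + scheduleCost c U (P ∪ L.toFinset) M := by
  induction L generalizing P with
  | nil => simp [scheduleCost]
  | cons f L ih =>
    simp only [List.cons_append, scheduleCost, ih, List.toFinset_cons, Finset.insert_union,
      Finset.union_insert]
    ring

theorem scheduleCost_congr {U W : Finset E → ℝ} (S : Finset E) (h : ∀ Q ⊆ S, U Q = W Q)
    (P : Finset E) (L : List E) (hPL : P ∪ L.toFinset ⊆ S) :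
    scheduleCost c U P L = scheduleCost c W P L := by
  induction L generalizing P with
  | nil => rfl
  | cons f L ih =>
    simp only [scheduleCost]
    rw [ih (insert f P) (by simpa [Finset.insert_union, Finset.union_insert] using hPL),
      h P (Finset.union_subset_left hPL)]

theorem scheduleCost_add (U W : Finset E → ℝ) (P : Finset E) (L : List E) :
    scheduleCost c (fun Q => U Q + W Q) P L = scheduleCost c U P L + scheduleCost c W P L := by
  induction L generalizing P with
  | nil => simp [scheduleCost]
  | cons f L ih => simp only [scheduleCost, ih]; ring

theorem scheduleCost_const_mul (a : ℝ) (U : Finset E → ℝ) (P : Finset E) (L : List E) :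
    scheduleCost c (fun Q => a * U Q) P L = a * scheduleCost c U P L := by
  induction L generalizing P with
  | nil => simp [scheduleCost]
  | cons f L ih => simp only [scheduleCost, ih]; ring

theorem scheduleCost_const (a : ℝ) (P : Finset E) (L : List E) :
    scheduleCost c (fun _ => a) P L = a * (L.map c).sum := by
  induction L generalizing P with
  | nil => simp [scheduleCost]
  | cons f L ih => simp only [scheduleCost, ih, List.map_cons, List.sum_cons]; ring

theorem scheduleCost_sum {ι : Type*} (s : Finset ι) (U : ι → Finset E → ℝ) (P : Finset E)
    (L : List E) :
    scheduleCost c (fun Q => ∑ i ∈ s, U i Q) P L = ∑ i ∈ s, scheduleCost c (U i) P L := by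
  induction L generalizing P with
  | nil => simp [scheduleCost]
  | cons f L ih => simp only [scheduleCost, ih, Finset.mul_sum, Finset.sum_add_distrib]

/-- The length of the shortest prefix with a monotone property is the cost of the indicator of
the failure of that property. -/
theorem sum_take_sInf_eq_scheduleCost (p : Finset E → Prop) [DecidablePred p]
    (hp : Monotone p) (P : Finset E) (L : List E) (hL : p (P ∪ L.toFinset)) :
    ((L.take (sInf {k : ℕ | p (P ∪ (L.take k).toFinset)})).map c).sum =
      scheduleCost c (fun Q => if p Q then 0 else 1) P L := by
  induction L generalizing P with
  | nil => simp [scheduleCost]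
  | cons f L ih =>
    by_cases hP : p P
    · have h0 : sInf {k : ℕ | p (P ∪ ((f :: L).take k).toFinset)} = 0 :=
        Nat.sInf_eq_zero.2 (Or.inl (by simpa using hP))
      have h1 := ih (insert f P) (by
        simpa [Finset.insert_union, Finset.union_insert] using hL)
      have h2 : sInf {k : ℕ | p (insert f P ∪ (L.take k).toFinset)} = 0 :=
        Nat.sInf_eq_zero.2 (Or.inl (by simpa using hp (Finset.subset_insert f P) hP))
      rw [h2] at h1
      simp only [List.take_zero, List.map_nil, List.sum_nil] at h1
      rw [h0]
      simp [scheduleCost, hP, ← h1]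
    · have h1 := ih (insert f P) (by
        simpa [Finset.insert_union, Finset.union_insert] using hL)
      have hne : {k : ℕ | p (P ∪ ((f :: L).take k).toFinset)}.Nonempty :=
        ⟨(f :: L).length, by simpa using hL⟩
      have hpos : 1 ≤ sInf {k : ℕ | p (P ∪ ((f :: L).take k).toFinset)} := by
        by_contra h
        have h0 : sInf {k : ℕ | p (P ∪ ((f :: L).take k).toFinset)} = 0 := by omega
        have := Nat.sInf_mem hne
        rw [h0] at this
        exact hP (by simpa using this)
      rw [← Nat.sInf_add hpos]
      simp only [List.take_succ_cons, List.map_cons, List.sum_cons, scheduleCost, hP, if_false,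
        mul_one, ← h1, List.toFinset_cons, Finset.insert_union, Finset.union_insert]

/-- Moving a minimizer `D` of `U + t c` to the front of the schedule strictly improves it
unless some prefix is a minimizer as well. -/
theorem scheduleCost_filter_lt {X D : Finset E} {U : Finset E → ℝ} {t : ℝ}
    (hc : ∀ f ∈ X, 0 < c f)
    (hU : ∀ P ⊆ X, ∀ Q ⊆ X, U (P ∪ Q) + U (P ∩ Q) ≤ U P + U Q)
    (hDX : D ⊆ X) (hD : ∀ S ⊆ X, U D + t * ∑ f ∈ D, c f ≤ U S + t * ∑ f ∈ S, c f)
    (L : List E) (P : Finset E) (hL : L.Nodup) (hPL : ∀ f ∈ L, f ∉ P)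
    (hX : P ∪ L.toFinset ⊆ X) (hDL : D ⊆ P ∪ L.toFinset) (hne : ∃ f ∈ L, f ∈ D)
    (hpre : ∀ k, U D + t * ∑ f ∈ D, c f <
      U (P ∪ (L.take k).toFinset) + t * ∑ f ∈ P ∪ (L.take k).toFinset, c f) :
    scheduleCost c U (P ∩ D) (L.filter (· ∈ D)) + scheduleCost c U (P ∪ D) (L.filter (· ∉ D)) <
      scheduleCost c U P L + t * (∑ f ∈ P \ D, c f) * ∑ f ∈ D \ P, c f := by
  induction L generalizing P with
  | nil => simp at hne
  | cons f L ih =>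
    have hPX : P ⊆ X := Finset.union_subset_left hX
    have hfX : f ∈ X := hX (by simp)
    have hfP : f ∉ P := hPL f (by simp)
    have hcf := hc f hfX
    have hset : insert f P ∪ L.toFinset = P ∪ (f :: L).toFinset := by
      simp [Finset.insert_union, Finset.union_insert]
    have hpre' : ∀ k, U D + t * ∑ f ∈ D, c f <
        U (insert f P ∪ (L.take k).toFinset) +
          t * ∑ f ∈ insert f P ∪ (L.take k).toFinset, c f := fun k => by
      simpa [Finset.insert_union, Finset.union_insert] using hpre (k + 1)
    have hPL' : ∀ g ∈ L, g ∉ insert f P := by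
      intro g hg
      have := hPL g (by simp [hg])
      simp only [Finset.mem_insert, not_or]
      exact ⟨fun h => (List.nodup_cons.1 hL).1 (h ▸ hg), this⟩
    have hsub := hU P hPX D hDX
    have hPD : ∑ g ∈ P, c g = ∑ g ∈ P \ D, c g + ∑ g ∈ P ∩ D, c g := by
      rw [add_comm, Finset.sum_inter_add_sum_sdiff]
    have hDP : ∑ g ∈ D, c g = ∑ g ∈ D \ P, c g + ∑ g ∈ P ∩ D, c g := by
      rw [add_comm, Finset.inter_comm, Finset.sum_inter_add_sum_sdiff]
    have hmod : ∑ g ∈ P ∪ D, c g = ∑ g ∈ P \ D, c g + ∑ g ∈ D, c g := by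
      rw [← Finset.sdiff_union_self_eq_union, Finset.sum_union Finset.sdiff_disjoint]
    have hmin1 := hD (P ∪ D) (Finset.union_subset hPX hDX)
    have hmin2 := hD (P ∩ D) (Finset.inter_subset_right.trans hDX)
    rw [hmod] at hmin1
    rw [hDP] at hmin2
    by_cases hfD : f ∈ D
    · have e1 : insert f P ∩ D = insert f (P ∩ D) := Finset.insert_inter_of_mem hfD
      have e2 : insert f P ∪ D = P ∪ D := by
        rw [Finset.insert_union, Finset.insert_eq_of_mem]; simp [hfD]
      have e3 : insert f P \ D = P \ D := Finset.insert_sdiff_of_mem _ hfD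
      have e4 : ∑ g ∈ D \ P, c g = c f + ∑ g ∈ D \ insert f P, c g := by
        have : D \ P = insert f (D \ insert f P) := by
          ext g; by_cases h : g = f <;> simp_all
        rw [this, Finset.sum_insert (by simp)]
      have hstep : U (P ∩ D) ≤ U P + t * ∑ g ∈ P \ D, c g := by linarith
      simp only [List.filter_cons, hfD, decide_true, if_true, not_true, decide_false,
        scheduleCost, e4]
      by_cases hne' : ∃ g ∈ L, g ∈ D
      · have := ih (insert f P) (List.nodup_cons.1 hL).2 hPL' (hset ▸ hX) (hset ▸ hDL) hne' hpre'
        rw [e1, e2, e3] at this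
        simp only [Bool.false_eq_true, if_false] at this ⊢
        nlinarith [mul_le_mul_of_nonneg_left hstep hcf.le]
      · push Not at hne'
        have hDP' : D ⊆ insert f P := fun g hg => by
          have := hDL hg
          rw [← hset, Finset.mem_union, List.mem_toFinset] at this
          exact this.resolve_right fun h => hne' g h hg
        have e5 : P ∪ D = insert f P := by
          rw [← e2, Finset.union_eq_left.2 hDP']
        have h0 := hpre' 0
        simp only [List.take_zero, List.toFinset_nil, Finset.union_empty, ← e5, hmod] at h0
        have hstep' : U (P ∩ D) < U P + t * ∑ g ∈ P \ D, c g := by linarith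
        have f1 : L.filter (· ∈ D) = [] := by
          simpa [List.filter_eq_nil_iff] using hne'
        have f2 : L.filter (· ∉ D) = L := by
          simpa [List.filter_eq_self] using hne'
        have f3 : D \ insert f P = ∅ := Finset.sdiff_eq_empty_iff_subset.2 hDP'
        rw [f1]
        simp only [Bool.false_eq_true, if_false]
        rw [f2, f3, e5]
        simp only [scheduleCost, Finset.sum_empty]
        nlinarith [mul_lt_mul_of_pos_left hstep' hcf]
    · have e1 : insert f P ∩ D = P ∩ D := Finset.insert_inter_of_notMem hfD
      have e2 : insert f P ∪ D = insert f (P ∪ D) := Finset.insert_union _ _ _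
      have e3 : ∑ g ∈ insert f P \ D, c g = c f + ∑ g ∈ P \ D, c g := by
        rw [Finset.insert_sdiff_of_notMem _ hfD, Finset.sum_insert (by simp [hfP])]
      have e4 : D \ insert f P = D \ P := by
        ext g; by_cases h : g = f <;> simp_all
      have hstep : U (P ∪ D) + t * ∑ g ∈ D \ P, c g ≤ U P := by linarith
      have hne' : ∃ g ∈ L, g ∈ D := by
        obtain ⟨g, hg, hgD⟩ := hne
        rcases List.mem_cons.1 hg with rfl | h
        · exact absurd hgD hfD
        · exact ⟨g, h, hgD⟩
      have := ih (insert f P) (List.nodup_cons.1 hL).2 hPL' (hset ▸ hX) (hset ▸ hDL) hne' hpre'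
      rw [e1, e2, e3, e4] at this
      simp only [List.filter_cons, hfD, decide_true, if_true, not_false_eq_true, decide_false,
        scheduleCost, Bool.false_eq_true, if_false]
      nlinarith [mul_le_mul_of_nonneg_left hstep hcf.le]

/-- An optimal schedule for a submodular `U` passes through a minimizer of `U + t c`, for
every `t`. -/
theorem exists_take_minimizer {X : Finset E} {U : Finset E → ℝ}
    (hc : ∀ f ∈ X, 0 < c f)
    (hU : ∀ P ⊆ X, ∀ Q ⊆ X, U (P ∪ Q) + U (P ∩ Q) ≤ U P + U Q)
    {L : List E} (hL : L.Nodup) (hLX : L.toFinset = X)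
    (hopt : ∀ M : List E, M.Nodup → M.toFinset = X →
      scheduleCost c U ∅ L ≤ scheduleCost c U ∅ M) (t : ℝ) :
    ∃ k ≤ L.length, ∀ S ⊆ X, U (L.take k).toFinset + t * ∑ f ∈ (L.take k).toFinset, c f ≤
      U S + t * ∑ f ∈ S, c f := by
  obtain ⟨D, hDX, hD⟩ := Finset.exists_min_image X.powerset
    (fun S => U S + t * ∑ f ∈ S, c f) ⟨∅, by simp⟩
  simp only [Finset.mem_powerset] at hDX hD
  by_contra! hcon
  have hpre : ∀ k, U D + t * ∑ f ∈ D, c f <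
      U (∅ ∪ (L.take k).toFinset) + t * ∑ f ∈ ∅ ∪ (L.take k).toFinset, c f := by
    intro k
    obtain ⟨S, hS, hlt⟩ := hcon (min k L.length) (min_le_right _ _)
    rw [← List.take_eq_take_min] at hlt
    simpa using (hD S hS).trans_lt hlt
  have hne : ∃ f ∈ L, f ∈ D := by
    by_contra! h
    have hD0 : D = ∅ := Finset.eq_empty_of_forall_notMem fun f hf =>
      h f (by rw [← List.mem_toFinset, hLX]; exact hDX hf) hf
    simpa [hD0] using hpre 0
  have hlt := scheduleCost_filter_lt hc hU hDX hD L ∅ hL (by simp) (by simp [hLX])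
    (by simpa [hLX] using hDX) hne hpre
  have hperm := List.filter_append_perm (· ∈ D) L
  have hle := hopt (L.filter (· ∈ D) ++ L.filter (fun f => !decide (f ∈ D)))
    (hperm.nodup_iff.2 hL) (by rw [List.toFinset_eq_of_perm _ _ hperm, hLX])
  have hDL : (L.filter (· ∈ D)).toFinset = D := by
    rw [List.toFinset_filter, hLX]
    ext f; simpa using @hDX f
  rw [scheduleCost_append, hDL] at hle
  simp at hlt hle
  linarith

/-- Pooling adjacent violators: indices chosen along a strictly increasing sequence that
minimizes every linear functional can be made monotone at no loss. -/
theorem exists_monotone_indices {α : Type*} (u x : α → ℝ) (U C : ℕ → ℝ) (m : ℕ)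
    (hC : ∀ i j, i < j → j ≤ m → C i < C j) (l : List ((ℝ × ℝ) × α))
    (hpos : ∀ p ∈ l, 0 < p.1.1) (hl : l.Pairwise fun p q => x p.2 ≤ x q.2)
    (hull : ∀ t : ℝ, ∃ k ≤ m, (∀ j ≤ m, U k + t * C k ≤ U j + t * C j) ∧
      ∀ p ∈ l, U k + t * C k ≤ u p.2 + t * x p.2) :
    ∃ l' : List ((ℝ × ℝ) × ℕ), l'.map Prod.fst = l.map Prod.fst ∧ (∀ p ∈ l', p.2 ≤ m) ∧
      l'.Pairwise (fun p q => p.2 ≤ q.2) ∧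
      (l'.map fun p => p.1.1 * U p.2 + p.1.2 * C p.2).sum ≤
        (l.map fun p => p.1.1 * u p.2 + p.1.2 * x p.2).sum := by
  induction hn : l.length using Nat.strong_induction_on generalizing l with
  | _ n ih =>
  by_cases hchain : l.IsChain fun p q => q.1.2 / q.1.1 ≤ p.1.2 / p.1.1
  · have : IsTrans ((ℝ × ℝ) × α) (fun p q => q.1.2 / q.1.1 ≤ p.1.2 / p.1.1) :=
      ⟨fun _ _ _ h h' => h'.trans h⟩
    choose k hkm hkU hk using hull
    refine ⟨l.map fun p => (p.1, k (p.1.2 / p.1.1)), by simp, ?_, ?_, ?_⟩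
    · simp only [List.mem_map]
      rintro _ ⟨p, -, rfl⟩
      exact hkm _
    · rw [List.pairwise_map]
      refine (List.isChain_iff_pairwise.1 hchain).imp fun {p q} hpq => ?_
      rcases hpq.eq_or_lt with h | h
      · rw [h]
      · by_contra! hlt
        have h1 := hkU (p.1.2 / p.1.1) _ (hkm (q.1.2 / q.1.1))
        have h2 := hkU (q.1.2 / q.1.1) _ (hkm (p.1.2 / p.1.1))
        nlinarith [hC _ _ hlt (hkm _)]
    · rw [List.map_map]
      refine List.sum_le_sum fun p hp => ?_
      have h1 := hpos p hp
      have h2 := mul_le_mul_of_nonneg_left (hk (p.1.2 / p.1.1) p hp) h1.le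
      have h3 : p.1.1 * (p.1.2 / p.1.1) = p.1.2 := mul_div_cancel₀ _ h1.ne'
      simp only [mul_add, ← mul_assoc, h3] at h2
      simpa using h2
  · rw [List.isChain_iff_forall_rel_of_append_cons_cons] at hchain
    push Not at hchain
    obtain ⟨p, q, l₁, l₂, rfl, hlt⟩ := hchain
    have hp := hpos p (by simp)
    have hq := hpos q (by simp)
    rw [div_lt_div_iff₀ hp hq] at hlt
    have hxpq : x p.2 ≤ x q.2 := by
      have := (List.pairwise_append.1 hl).2.1
      exact (List.pairwise_cons.1 this).1 q (by simp)
    obtain ⟨a, ha, hcost⟩ : ∃ a, (a = p.2 ∨ a = q.2) ∧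
        (p.1.1 + q.1.1) * u a + (p.1.2 + q.1.2) * x a ≤
          (p.1.1 * u p.2 + p.1.2 * x p.2) + (q.1.1 * u q.2 + q.1.2 * x q.2) := by
      rcases le_or_gt (p.1.1 * (u q.2 - u p.2) + p.1.2 * (x q.2 - x p.2)) 0 with h | h
      · exact ⟨q.2, Or.inr rfl, by linarith⟩
      · refine ⟨p.2, Or.inl rfl, ?_⟩
        have h1 : 0 < p.1.1 * (q.1.1 * (u q.2 - u p.2) + q.1.2 * (x q.2 - x p.2)) := by
          nlinarith [mul_pos hq h, mul_le_mul_of_nonneg_right hlt.le (sub_nonneg.2 hxpq)]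
        have h2 := pos_of_mul_pos_right h1 hp.le
        linarith
    obtain ⟨l', h1, h2, h3, h4⟩ := ih (l₁ ++ ((p.1 + q.1), a) :: l₂).length
      (by simp [← hn]) (l₁ ++ ((p.1 + q.1), a) :: l₂)
      (by
        intro r hr
        simp only [List.mem_append, List.mem_cons] at hr
        rcases hr with hr | rfl | hr
        · exact hpos r (by simp [hr])
        · exact add_pos hp hq
        · exact hpos r (by simp [hr]))
      (by
        simp only [List.pairwise_append, List.pairwise_cons, List.mem_cons] at hl ⊢
        rcases ha with rfl | rfl <;> grind)
      (fun t => by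
        obtain ⟨k, hk, hkU, h⟩ := hull t
        refine ⟨k, hk, hkU, fun r hr => ?_⟩
        simp only [List.mem_append, List.mem_cons] at hr
        rcases hr with hr | rfl | hr
        · exact h r (by simp [hr])
        · rcases ha with rfl | rfl
          · exact h p (by simp)
          · exact h q (by simp)
        · exact h r (by simp [hr]))
      rfl
    rw [List.map_append, List.map_cons, List.map_eq_append_iff] at h1
    obtain ⟨m₁, m₂', rfl, e1, e2⟩ := h1
    obtain ⟨r, m₂, rfl, e3, e4⟩ := List.map_eq_cons_iff.1 e2
    refine ⟨m₁ ++ (p.1, r.2) :: (q.1, r.2) :: m₂, by simp [e1, e4], ?_, ?_, ?_⟩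
    · simp only [List.mem_append, List.mem_cons] at h2 ⊢
      grind
    · simp only [List.pairwise_append, List.pairwise_cons, List.mem_cons] at h3 ⊢
      obtain ⟨g1, ⟨g2, g3⟩, g4⟩ := h3
      refine ⟨g1, ⟨?_, g2, g3⟩, ?_⟩
      · rintro s (rfl | hs)
        exacts [le_rfl, g2 s hs]
      · rintro s hs t (rfl | rfl | ht)
        exacts [g4 s hs r (Or.inl rfl), g4 s hs r (Or.inl rfl), g4 s hs t (Or.inr ht)]
    · simp only [List.map_append, List.map_cons, List.sum_append, List.sum_cons, e3,
        Prod.fst_add, Prod.snd_add] at h4 ⊢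
      linarith

/-- The elements outside `X` of a schedule `N` started with the parts `P` and `R` built, each
recorded as its length, the drop of `W` it causes, and the first part at that moment. -/
def slots (c : E → ℝ) (W : Finset E → ℝ) (X : Finset E) :
    Finset E → Finset E → List E → List ((ℝ × ℝ) × Finset E)
  | _, _, [] => []
  | P, R, f :: N => if f ∈ X then slots c W X (insert f P) R N
      else ((c f, W R - W (insert f R)), P) :: slots c W X P (insert f R) N

theorem slots_bounds (W : Finset E → ℝ) {X P : Finset E} (R : Finset E) {N : List E}
    (hP : P ⊆ X) (hN : ∀ f ∈ N, 0 < c f) :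
    ∀ p ∈ slots c W X P R N, 0 < p.1.1 ∧ P ⊆ p.2 ∧ p.2 ⊆ X := by
  induction N generalizing P R with
  | nil => simp [slots]
  | cons f N ih =>
    have hN' : ∀ g ∈ N, 0 < c g := fun g hg => hN g (by simp [hg])
    by_cases hf : f ∈ X
    · intro p hp
      simp only [slots, hf, if_true] at hp
      obtain ⟨h1, h2, h3⟩ := ih R (Finset.insert_subset hf hP) hN' p hp
      exact ⟨h1, (Finset.subset_insert f P).trans h2, h3⟩
    · intro p hp
      simp only [slots, hf, if_false, List.mem_cons] at hp
      rcases hp with rfl | hp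
      · exact ⟨hN f (by simp), subset_rfl, hP⟩
      · exact ih _ hP hN' p hp

theorem slots_pairwise (W : Finset E → ℝ) {X P : Finset E} (R : Finset E) {N : List E}
    (hP : P ⊆ X) (hN : ∀ f ∈ N, 0 < c f) :
    (slots c W X P R N).Pairwise fun p q => p.2 ⊆ q.2 := by
  induction N generalizing P R with
  | nil => simp [slots]
  | cons f N ih =>
    have hN' : ∀ g ∈ N, 0 < c g := fun g hg => hN g (by simp [hg])
    by_cases hf : f ∈ X
    · simpa only [slots, hf, if_true] using ih R (Finset.insert_subset hf hP) hN'
    · simp only [slots, hf, if_false, List.pairwise_cons]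
      exact ⟨fun q hq => (slots_bounds W _ hP hN' q hq).2.1, ih _ hP hN'⟩

theorem slots_append_of_subset (W : Finset E → ℝ) (X P R : Finset E) (L N : List E)
    (hL : ∀ f ∈ L, f ∈ X) :
    slots c W X P R (L ++ N) = slots c W X (P ∪ L.toFinset) R N := by
  induction L generalizing P with
  | nil => simp
  | cons f L ih =>
    have hf : f ∈ X := hL f (by simp)
    simp only [List.cons_append, slots, hf, if_true, List.toFinset_cons]
    rw [ih _ fun g hg => hL g (by simp [hg])]
    simp [Finset.insert_union, Finset.union_insert]

/-- The cost of a merged schedule in terms of its two restrictions and its slots. -/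
theorem scheduleCost_merge (U W : Finset E → ℝ) {X Y : Finset E} (hXY : Disjoint X Y)
    (Q : Finset E) (N : List E) (hN : N.Nodup) (hQN : ∀ f ∈ N, f ∉ Q)
    (hNXY : ∀ f ∈ N, f ∈ X ∪ Y) :
    scheduleCost c (fun S => U (S ∩ X) + W (S ∩ Y)) Q N + (∑ f ∈ Q ∩ X, c f) * W (Q ∩ Y) =
      scheduleCost c U (Q ∩ X) (N.filter (· ∈ X)) + scheduleCost c W (Q ∩ Y) (N.filter (· ∉ X)) +
      ((slots c W X (Q ∩ X) (Q ∩ Y) N).map fun p =>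
        p.1.1 * U p.2 + p.1.2 * ∑ f ∈ p.2, c f).sum +
      (∑ f ∈ Q ∩ X, c f + ((N.filter (· ∈ X)).map c).sum) *
        W (Q ∩ Y ∪ (N.filter (· ∉ X)).toFinset) := by
  induction N generalizing Q with
  | nil => simp [scheduleCost, slots]
  | cons f N ih =>
    have hfQ : f ∉ Q := hQN f (by simp)
    have := ih (insert f Q) (List.nodup_cons.1 hN).2
      (by
        intro g hg
        simp only [Finset.mem_insert, not_or]
        exact ⟨fun h => (List.nodup_cons.1 hN).1 (h ▸ hg), hQN g (by simp [hg])⟩)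
      (fun g hg => hNXY g (by simp [hg]))
    by_cases hf : f ∈ X
    · have hfY : f ∉ Y := Finset.disjoint_left.1 hXY hf
      rw [Finset.insert_inter_of_mem hf, Finset.insert_inter_of_notMem hfY,
        Finset.sum_insert (by simp [hfQ])] at this
      simp [scheduleCost, slots, hf] at this ⊢
      linarith
    · have hfY : f ∈ Y := (Finset.mem_union.1 (hNXY f (by simp))).resolve_left hf
      rw [Finset.insert_inter_of_notMem hf, Finset.insert_inter_of_mem hfY] at this
      simp [scheduleCost, slots, hf, Finset.insert_union, Finset.union_insert] at this ⊢
      linarith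

/-- A merge of `L` with the elements of `N` outside `X` with prescribed slots exists. -/
theorem exists_merge (W : Finset E → ℝ) {X : Finset E} {L : List E}
    (hLX : L.toFinset = X) (N : List E) (P R : Finset E) (i : ℕ) (l : List ((ℝ × ℝ) × ℕ))
    (hl : l.map Prod.fst = (slots c W X P R N).map Prod.fst)
    (hi : ∀ p ∈ l, i ≤ p.2) (hmono : l.Pairwise fun p q => p.2 ≤ q.2) :
    ∃ M : List E, M.filter (· ∈ X) = L.drop i ∧ M.filter (· ∉ X) = N.filter (· ∉ X) ∧
      slots c W X (L.take i).toFinset R M = l.map fun p => (p.1, (L.take p.2).toFinset) := by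
  have hmem : ∀ f ∈ L, f ∈ X := fun f hf => hLX ▸ List.mem_toFinset.2 hf
  induction N generalizing P R i l with
  | nil =>
    obtain rfl : l = [] := by simpa [slots] using hl
    have hd : ∀ f ∈ L.drop i, f ∈ X := fun f hf => hmem f (List.mem_of_mem_drop hf)
    refine ⟨L.drop i, by simpa [List.filter_eq_self] using hd,
      by simpa [List.filter_eq_nil_iff] using hd, ?_⟩
    have := slots_append_of_subset (c := c) W X (L.take i).toFinset R (L.drop i) [] hd
    simpa [slots] using this
  | cons f N ih =>
    by_cases hf : f ∈ X
    · simp only [slots, hf, if_true] at hl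
      obtain ⟨M, h1, h2, h3⟩ := ih _ R i l hl hi hmono
      exact ⟨M, h1, by simpa [hf] using h2, h3⟩
    · simp only [slots, hf, if_false, List.map_cons] at hl
      obtain ⟨p, l, rfl, hp, hl⟩ := List.map_eq_cons_iff.1 hl
      rw [List.pairwise_cons] at hmono
      obtain ⟨M, h1, h2, h3⟩ := ih P (insert f R) p.2 l hl hmono.1 hmono.2
      have hip : i ≤ p.2 := hi p (by simp)
      have hd : ∀ g ∈ (L.drop i).take (p.2 - i), g ∈ X := fun g hg =>
        hmem g (List.mem_of_mem_drop (List.mem_of_mem_take hg))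
      have htake : L.take i ++ (L.drop i).take (p.2 - i) = L.take p.2 := by
        rw [← List.take_add]; congr 1; omega
      have hdrop : (L.drop i).take (p.2 - i) ++ L.drop p.2 = L.drop i := by
        conv_rhs => rw [← List.take_append_drop (p.2 - i) (L.drop i), List.drop_drop]
        congr 2; omega
      refine ⟨(L.drop i).take (p.2 - i) ++ f :: M, ?_, ?_, ?_⟩
      · rw [List.filter_append, List.filter_eq_self.2 (by simpa using hd),
          List.filter_cons_of_neg (by simpa using hf), h1, hdrop]
      · rw [List.filter_append, List.filter_eq_nil_iff.2 (by simpa using hd), List.nil_append,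
          List.filter_cons_of_pos (by simpa using hf), h2,
          List.filter_cons_of_pos (by simpa using hf)]
      · rw [slots_append_of_subset W X _ R _ _ hd, ← List.toFinset_append, htake]
        simp [slots, hf, h3, ← hp]

/-- The part of a merged schedule on `X` can be replaced by an optimal schedule of `X`, keeping
the order of the other part. -/
theorem exists_merge_le {X Y : Finset E} (hXY : Disjoint X Y) (hc : ∀ f ∈ X ∪ Y, 0 < c f)
    {U : Finset E → ℝ} (W : Finset E → ℝ)
    (hU : ∀ P ⊆ X, ∀ Q ⊆ X, U (P ∪ Q) + U (P ∩ Q) ≤ U P + U Q)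
    {L : List E} (hL : L.Nodup) (hLX : L.toFinset = X)
    (hopt : ∀ M : List E, M.Nodup → M.toFinset = X →
      scheduleCost c U ∅ L ≤ scheduleCost c U ∅ M)
    {N : List E} (hN : N.Nodup) (hNXY : N.toFinset = X ∪ Y) :
    ∃ M : List E, M.Perm N ∧ M.filter (· ∈ X) = L ∧ M.filter (· ∉ X) = N.filter (· ∉ X) ∧
      scheduleCost c (fun S => U (S ∩ X) + W (S ∩ Y)) ∅ M ≤
        scheduleCost c (fun S => U (S ∩ X) + W (S ∩ Y)) ∅ N := by
  have hmemN : ∀ f ∈ N, f ∈ X ∪ Y := fun f hf => hNXY ▸ List.mem_toFinset.2 hf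
  have hcN : ∀ f ∈ N, 0 < c f := fun f hf => hc f (hmemN f hf)
  have hcX : ∀ f ∈ X, 0 < c f := fun f hf => hc f (Finset.mem_union_left _ hf)
  have hbd := slots_bounds W ∅ (Finset.empty_subset X) hcN
  obtain ⟨l, h1, h2, h3, h4⟩ := exists_monotone_indices U (fun S => ∑ f ∈ S, c f)
    (fun k => U (L.take k).toFinset) (fun k => ∑ f ∈ (L.take k).toFinset, c f) L.length
    (by
      intro i j hij hj
      have hjL := List.Nodup.sublist (List.take_sublist j L) hL
      have hiL := List.Nodup.sublist (List.take_sublist i L) hL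
      refine Finset.sum_lt_sum_of_subset (i := L[i]'(by omega)) ?_ ?_ ?_ ?_ ?_
      · intro f hf
        rw [List.mem_toFinset] at hf ⊢
        exact (List.take_subset_take_left L hij.le) hf
      · rw [List.mem_toFinset, List.mem_take_iff_getElem]
        exact ⟨i, by omega, rfl⟩
      · rw [List.mem_toFinset, List.mem_take_iff_getElem]
        rintro ⟨k, hk, e⟩
        have := (hL.getElem_inj_iff).1 e
        omega
      · exact hcX _ (hLX ▸ List.mem_toFinset.2 (List.getElem_mem _))
      · intro f hf _
        exact (hcX f (hLX ▸ List.mem_toFinset.2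
          (List.mem_of_mem_take (List.mem_toFinset.1 hf)))).le)
    (slots c W X ∅ ∅ N) (fun p hp => (hbd p hp).1)
    ((slots_pairwise W ∅ (Finset.empty_subset X) hcN).imp_of_mem fun {p q} _ hq h =>
      Finset.sum_le_sum_of_subset_of_nonneg h fun f hf _ => (hcX f ((hbd q hq).2.2 hf)).le)
    (fun t => by
      obtain ⟨k, hk, h⟩ := exists_take_minimizer hcX hU hL hLX hopt t
      exact ⟨k, hk, fun j _ => h _ fun f hf => hLX ▸ List.mem_toFinset.2
        (List.mem_of_mem_take (List.mem_toFinset.1 hf)), fun p hp => h p.2 (hbd p hp).2.2⟩)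
  obtain ⟨M, e1, e2, e3⟩ := exists_merge W hLX N ∅ ∅ 0 l h1 (by simp) h3
  have hNX : (N.filter (· ∈ X)).toFinset = X := by
    ext f
    simp only [List.toFinset_filter, hNXY, Finset.mem_filter, Finset.mem_union, decide_eq_true_eq]
    tauto
  have hNXn := hN.filter (· ∈ X)
  rw [List.drop_zero] at e1
  have hLN : L.Perm (N.filter (· ∈ X)) :=
    List.perm_of_nodup_nodup_toFinset_eq hL hNXn (hLX.trans hNX.symm)
  have hMN : M.Perm N := by
    have p1 := List.filter_append_perm (· ∈ X) M
    have p2 := List.filter_append_perm (· ∈ X) N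
    simp only [decide_not] at e1 e2
    rw [e1, e2] at p1
    exact p1.symm.trans ((hLN.append_right _).trans p2)
  refine ⟨M, hMN, e1, e2, ?_⟩
  have f1 := scheduleCost_merge (c := c) U W hXY ∅ N hN (by simp) hmemN
  have f2 := scheduleCost_merge (c := c) U W hXY ∅ M (hMN.nodup_iff.2 hN) (by simp)
    fun f hf => hmemN f (hMN.subset hf)
  rw [e1, e2] at f2
  simp only [Finset.empty_inter, Finset.sum_empty, zero_mul, add_zero, zero_add,
    Finset.empty_union] at f1 f2
  rw [List.take_zero, List.toFinset_nil] at e3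
  rw [e3, List.map_map] at f2
  rw [(hLN.map c).sum_eq] at f2
  have := hopt _ hNXn hNX
  simp only [Function.comp_def] at f2
  linarith

end Schedule

/-- The edges in `P` connect the two vertices of `q`. -/
def Joins {V : Type} (P : Set (Sym2 V)) (q : Sym2 V) : Prop :=
  ∀ x ∈ q, ∀ y ∈ q, (SimpleGraph.fromEdgeSet P).Reachable x y

open Classical in
/-- The total weight of the pairs of vertices in `A` that `P` does not connect. -/
noncomputable def unjoinedWeight {V : Type} [Fintype V] (w : Sym2 V → ℝ) (A : Set V)
    (P : Finset (Sym2 V)) : ℝ :=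
  ∑ q : Sym2 V, if (∀ x ∈ q, x ∈ A) ∧ ¬ Joins (P : Set (Sym2 V)) q then w q else 0

theorem Joins.mono {V : Type} {P Q : Set (Sym2 V)} {q : Sym2 V} (h : Joins P q) (hPQ : P ⊆ Q) :
    Joins Q q :=
  fun x hx y hy => (h x hx y hy).mono (SimpleGraph.fromEdgeSet_mono hPQ)

/-- In a forest, a pair connected by two edge sets is connected by their intersection. -/
theorem Joins.inter {V : Type} {G : SimpleGraph V} (hG : G.IsAcyclic) {P Q : Set (Sym2 V)}
    (hP : P ⊆ G.edgeSet) (hQ : Q ⊆ G.edgeSet) {q : Sym2 V} (h : Joins P q) (h' : Joins Q q) :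
    Joins (P ∩ Q) q := by
  intro x hx y hy
  have le_of_subset : ∀ {S : Set (Sym2 V)}, S ⊆ G.edgeSet → SimpleGraph.fromEdgeSet S ≤ G :=
    fun hS => by simpa using SimpleGraph.fromEdgeSet_mono hS
  obtain ⟨p, hp⟩ := (h x hx y hy).exists_isPath
  obtain ⟨p', hp'⟩ := (h' x hx y hy).exists_isPath
  have heq := (hG.subsingleton_path x y).elim ⟨p.mapLe (le_of_subset hP), hp.mapLe _⟩
    ⟨p'.mapLe (le_of_subset hQ), hp'.mapLe _⟩
  have hedges : p.edges = p'.edges := by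
    have := congrArg (fun r : G.Path x y => r.1.edges) heq
    simpa using this
  refine ⟨p.transfer _ fun e he => ?_⟩
  have h1 := p.edges_subset_edgeSet he
  have h2 := p'.edges_subset_edgeSet (hedges ▸ he)
  rw [SimpleGraph.edgeSet_fromEdgeSet] at h1 h2 ⊢
  exact ⟨⟨h1.1, h2.1⟩, h1.2⟩

theorem unjoinedWeight_submodular {V : Type} [Fintype V] [DecidableEq V] {G : SimpleGraph V}
    (hG : G.IsAcyclic) {w : Sym2 V → ℝ} (hw : ∀ q, 0 ≤ w q) (A : Set V) {P Q : Finset (Sym2 V)}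
    (hP : (P : Set (Sym2 V)) ⊆ G.edgeSet) (hQ : (Q : Set (Sym2 V)) ⊆ G.edgeSet) :
    unjoinedWeight w A (P ∪ Q) + unjoinedWeight w A (P ∩ Q) ≤
      unjoinedWeight w A P + unjoinedWeight w A Q := by
  classical
  simp only [unjoinedWeight, ← Finset.sum_add_distrib]
  refine Finset.sum_le_sum fun q _ => ?_
  have h1 : Joins (P : Set (Sym2 V)) q → Joins ((P ∪ Q : Finset (Sym2 V)) : Set (Sym2 V)) q :=
    fun h => h.mono (by simp)
  have h2 : Joins (Q : Set (Sym2 V)) q → Joins ((P ∪ Q : Finset (Sym2 V)) : Set (Sym2 V)) q :=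
    fun h => h.mono (by simp)
  have h3 : Joins (P : Set (Sym2 V)) q → Joins (Q : Set (Sym2 V)) q →
      Joins ((P ∩ Q : Finset (Sym2 V)) : Set (Sym2 V)) q :=
    fun h h' => by simpa using h.inter hG hP hQ h'
  have := hw q
  split_ifs <;> first | linarith | (exfalso; tauto)

theorem pairTime_eq_scheduleCost {V : Type} [DecidableEq V] (c : Sym2 V → ℝ)
    (L : List (Sym2 V)) (q : Sym2 V)
    [DecidablePred fun P : Finset (Sym2 V) => Joins (P : Set (Sym2 V)) q]
    (h : Joins {e | e ∈ L} q) :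
    pairTime c L q =
      scheduleCost c (fun P => if Joins (P : Set (Sym2 V)) q then 0 else 1) ∅ L := by
  rw [← sum_take_sInf_eq_scheduleCost (c := c) (fun P => Joins (P : Set (Sym2 V)) q)
    (fun P Q hPQ hP => hP.mono (Finset.coe_subset.2 hPQ)) ∅ L (by simpa using h)]
  simp [pairTime, Joins]

theorem treeObj_eq_scheduleCost {V : Type} [Fintype V] [DecidableEq V] (c w : Sym2 V → ℝ)
    (A : Set V) (L : List (Sym2 V)) (h : ∀ q : Sym2 V, (∀ x ∈ q, x ∈ A) → Joins {e | e ∈ L} q) :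
    treeObj c w A L = scheduleCost c (unjoinedWeight w A) ∅ L := by
  classical
  unfold unjoinedWeight treeObj
  rw [scheduleCost_sum]
  refine Finset.sum_congr rfl fun q _ => ?_
  split_ifs with hq
  · rw [pairTime_eq_scheduleCost c L q (h q hq), ← scheduleCost_const_mul]
    congr 1
    funext P
    split_ifs <;> first | (simp; done) | (exfalso; tauto)
  · simp [hq, scheduleCost_const]

/-- A walk along edges of `H` stays in a component of `H` and uses only edges inside it. -/
theorem reachable_within_component {V : Type} {H : SimpleGraph V} {a x y : V}
    {P Q : Set (Sym2 V)} (hP : P ⊆ H.edgeSet)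
    (hPQ : ∀ e ∈ P, (∀ z ∈ e, H.Reachable a z) → e ∈ Q) (hx : H.Reachable a x)
    (h : (SimpleGraph.fromEdgeSet P).Reachable x y) :
    H.Reachable a y ∧ (SimpleGraph.fromEdgeSet Q).Reachable x y := by
  obtain ⟨p⟩ := h
  induction p with
  | nil => exact ⟨hx, SimpleGraph.Reachable.refl _⟩
  | @cons u v _ huv p ih =>
    rw [SimpleGraph.fromEdgeSet_adj] at huv
    have hv : H.Reachable a v := hx.trans (SimpleGraph.Adj.reachable (hP huv.1))
    have hQ : (SimpleGraph.fromEdgeSet Q).Adj u v :=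
      (SimpleGraph.fromEdgeSet_adj _).2 ⟨hPQ _ huv.1 (by simp [hx, hv]), huv.2⟩
    exact ⟨(ih hv).1, hQ.reachable.trans (ih hv).2⟩

theorem joins_within_component {V : Type} {H : SimpleGraph V} {a : V} {P Q : Set (Sym2 V)}
    (hP : P ⊆ H.edgeSet) (hPQ : ∀ e ∈ P, (∀ z ∈ e, H.Reachable a z) → e ∈ Q) {q : Sym2 V}
    (hq : ∀ x ∈ q, H.Reachable a x) (h : Joins P q) : Joins Q q :=
  fun x hx y hy => (reachable_within_component hP hPQ (hq x hx) (h x hx y hy)).2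

theorem SimpleGraph.Reachable.joins {V : Type} {H : SimpleGraph V} {a : V} {q : Sym2 V}
    (hq : ∀ x ∈ q, H.Reachable a x) : Joins H.edgeSet q :=
  fun x hx y hy => by simpa using (hq x hx).symm.trans (hq y hy)

/-- Deleting an edge of a connected graph leaves at most two components. -/
theorem SimpleGraph.Connected.reachable_deleteEdges_or {V : Type} {G : SimpleGraph V}
    (hG : G.Connected) (a b v : V) :
    (G.deleteEdges {s(a, b)}).Reachable a v ∨ (G.deleteEdges {s(a, b)}).Reachable b v := by
  suffices ∀ {u v : V}, G.Walk u v →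
      (G.deleteEdges {s(a, b)}).Reachable a u ∨ (G.deleteEdges {s(a, b)}).Reachable b u →
      (G.deleteEdges {s(a, b)}).Reachable a v ∨ (G.deleteEdges {s(a, b)}).Reachable b v by
    obtain ⟨p⟩ := hG.preconnected a v
    exact this p (Or.inl (SimpleGraph.Reachable.refl _))
  intro u v p
  induction p with
  | nil => exact id
  | @cons u v _ huv p ih =>
    intro hu
    apply ih
    by_cases he : s(u, v) = s(a, b)
    · rw [Sym2.eq_iff] at he
      rcases he with ⟨-, rfl⟩ | ⟨-, rfl⟩
      · exact Or.inr (SimpleGraph.Reachable.refl _)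
      · exact Or.inl (SimpleGraph.Reachable.refl _)
    · have hadj : (G.deleteEdges {s(a, b)}).Adj u v := by
        rw [SimpleGraph.deleteEdges_adj]; exact ⟨huv, he⟩
      exact hu.imp (·.trans hadj.reachable) (·.trans hadj.reachable)

open Classical in
/-- Before the edge joining them is built, the two components contribute independently, and the
pairs between them contribute a constant. -/
theorem unjoinedWeight_univ_eq {V : Type} [Fintype V] {H : SimpleGraph V}
    {a b : V} (hab : ¬ H.Reachable a b) (hcover : ∀ v, H.Reachable a v ∨ H.Reachable b v)
    (w : Sym2 V → ℝ) {P PA PB : Finset (Sym2 V)} (hP : (P : Set (Sym2 V)) ⊆ H.edgeSet)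
    (hPA : ∀ e, e ∈ PA ↔ e ∈ P ∧ ∀ x ∈ e, H.Reachable a x)
    (hPB : ∀ e, e ∈ PB ↔ e ∈ P ∧ ∀ x ∈ e, H.Reachable b x) :
    unjoinedWeight w Set.univ P =
      unjoinedWeight w {v | H.Reachable a v} PA + unjoinedWeight w {v | H.Reachable b v} PB +
      ∑ q : Sym2 V, if (∀ x ∈ q, H.Reachable a x) ∨ (∀ x ∈ q, H.Reachable b x)
        then 0 else w q := by
  simp only [unjoinedWeight, ← Finset.sum_add_distrib, Set.mem_univ, implies_true, true_and,
    Set.mem_ofPred_eq]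
  refine Finset.sum_congr rfl fun q _ => ?_
  have hnot : ¬ ((∀ x ∈ q, H.Reachable a x) ∧ ∀ x ∈ q, H.Reachable b x) := by
    induction q using Sym2.ind with
    | _ x y => exact fun h => hab ((h.1 x (by simp)).trans (h.2 x (by simp)).symm)
  have hA : (∀ x ∈ q, H.Reachable a x) →
      (Joins (P : Set (Sym2 V)) q ↔ Joins (PA : Set (Sym2 V)) q) := fun hq =>
    ⟨joins_within_component hP (fun e he h => (hPA e).2 ⟨he, h⟩) hq,
      fun h => h.mono fun e he => ((hPA e).1 he).1⟩
  have hB : (∀ x ∈ q, H.Reachable b x) →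
      (Joins (P : Set (Sym2 V)) q ↔ Joins (PB : Set (Sym2 V)) q) := fun hq =>
    ⟨joins_within_component hP (fun e he h => (hPB e).2 ⟨he, h⟩) hq,
      fun h => h.mono fun e he => ((hPB e).1 he).1⟩
  have hcross : Joins (P : Set (Sym2 V)) q →
      (∀ x ∈ q, H.Reachable a x) ∨ (∀ x ∈ q, H.Reachable b x) := by
    induction q using Sym2.ind with
    | _ x y =>
      intro h
      exact (hcover x).imp
        (fun hx z hz => (reachable_within_component (Q := Set.univ) hP (by simp) hx
          (h x (by simp) z hz)).1)
        (fun hx z hz => (reachable_within_component (Q := Set.univ) hP (by simp) hx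
          (h x (by simp) z hz)).1)
  by_cases hj : Joins (P : Set (Sym2 V)) q
  · have h1 : ¬ ((∀ x ∈ q, H.Reachable a x) ∧ ¬ Joins (PA : Set (Sym2 V)) q) :=
      fun h => h.2 ((hA h.1).1 hj)
    have h2 : ¬ ((∀ x ∈ q, H.Reachable b x) ∧ ¬ Joins (PB : Set (Sym2 V)) q) :=
      fun h => h.2 ((hB h.1).1 hj)
    rw [if_neg (not_not.2 hj), if_neg h1, if_neg h2, if_pos (hcross hj)]
    simp
  · rw [if_pos hj]
    by_cases h1 : ∀ x ∈ q, H.Reachable a x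
    · have h2 : ¬ ((∀ x ∈ q, H.Reachable b x) ∧ ¬ Joins (PB : Set (Sym2 V)) q) :=
        fun h => hnot ⟨h1, h.1⟩
      rw [if_pos ⟨h1, mt (hA h1).2 hj⟩, if_neg h2, if_pos (Or.inl h1)]
      simp
    · rw [if_neg (mt And.left h1)]
      by_cases h2 : ∀ x ∈ q, H.Reachable b x
      · rw [if_pos ⟨h2, mt (hB h2).2 hj⟩, if_pos (Or.inr h2)]
        simp
      · rw [if_neg (mt And.left h2), if_neg (not_or.2 ⟨h1, h2⟩)]
        simp

/-- Lemma 1 / lemT1: let `T` be a tree, `e = s(a,b)` an edge of `T`, and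
`T′, T″` the two components of `T − e`, with vertex sets `A, B` and edge sets `EA, EB`.
If `L′` minimizes `Z_{T′}` over orderings of `EA` and `L″` minimizes `Z_{T″}` over
orderings of `EB`, then among the orderings of the edges of `T` constructing `e` last
there is one minimizing `Z_T` whose restrictions to `EA` and `EB` are `L′` and `L″`
(i.e. which contains both `L′` and `L″` as subsequences). -/
theorem stmt13 (V : Type) [Fintype V] [DecidableEq V] (G : SimpleGraph V)
    (hT : G.IsTree) (c : Sym2 V → ℝ) (hc : ∀ e ∈ G.edgeSet, 0 < c e)
    (w : Sym2 V → ℝ) (hw : ∀ q, 0 ≤ w q)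
    (a b : V) (hab : G.Adj a b)
    (A B : Set V)
    (hA : A = {v | (G.deleteEdges {s(a, b)}).Reachable a v})
    (hB : B = {v | (G.deleteEdges {s(a, b)}).Reachable b v})
    (EA EB : Set (Sym2 V))
    (hEA : EA = {e ∈ G.edgeSet | ∀ x ∈ e, x ∈ A})
    (hEB : EB = {e ∈ G.edgeSet | ∀ x ∈ e, x ∈ B})
    (L' : List (Sym2 V)) (hL' : IsOrdering L' EA)
    (hopt' : ∀ M, IsOrdering M EA → treeObj c w A L' ≤ treeObj c w A M)
    (L'' : List (Sym2 V)) (hL'' : IsOrdering L'' EB)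
    (hopt'' : ∀ M, IsOrdering M EB → treeObj c w B L'' ≤ treeObj c w B M) :
    ∃ L : List (Sym2 V), IsOrdering L G.edgeSet ∧ L.getLast? = some s(a, b) ∧
      (∀ M, IsOrdering M G.edgeSet → M.getLast? = some s(a, b) →
        treeObj c w Set.univ L ≤ treeObj c w Set.univ M) ∧
      L'.Sublist L ∧ L''.Sublist L := by
  subst hA hB hEA hEB
  set H := G.deleteEdges {s(a, b)} with hH
  have hHe : H.edgeSet = G.edgeSet \ {s(a, b)} := SimpleGraph.edgeSet_deleteEdges _
  have hnot : ¬ H.Reachable a b :=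
    SimpleGraph.isBridge_iff.1 (SimpleGraph.isAcyclic_iff_forall_adj_isBridge.1 hT.isAcyclic hab)
  have hcover : ∀ v, H.Reachable a v ∨ H.Reachable b v :=
    hT.connected.reachable_deleteEdges_or a b
  have hmemA : ∀ e, e ∈ L'.toFinset ↔ e ∈ H.edgeSet ∧ ∀ x ∈ e, H.Reachable a x := by
    intro e
    rw [List.mem_toFinset, hL'.2, hHe]
    refine ⟨fun h => ⟨⟨h.1, ?_⟩, h.2⟩, fun h => ⟨h.1.1, h.2⟩⟩
    rintro rfl
    exact hnot (h.2 b (by simp))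
  have hmemB : ∀ e, e ∈ L''.toFinset ↔ e ∈ H.edgeSet ∧ ∀ x ∈ e, H.Reachable b x := by
    intro e
    rw [List.mem_toFinset, hL''.2, hHe]
    refine ⟨fun h => ⟨⟨h.1, ?_⟩, h.2⟩, fun h => ⟨h.1.1, h.2⟩⟩
    rintro rfl
    exact hnot (h.2 a (by simp)).symm
  set X := L'.toFinset with hX
  set Y := L''.toFinset with hY
  have hXY : Disjoint X Y := by
    rw [Finset.disjoint_left]
    intro e heX heY
    have h1 := ((hmemA e).1 heX).2
    have h2 := ((hmemB e).1 heY).2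
    induction e using Sym2.ind with
    | _ x y => exact hnot ((h1 x (by simp)).trans (h2 x (by simp)).symm)
  have hmemXY : ∀ e, e ∈ X ∪ Y ↔ e ∈ H.edgeSet := by
    intro e
    rw [Finset.mem_union, hmemA, hmemB, ← and_or_left, and_iff_left_iff_imp]
    induction e using Sym2.ind with
    | _ x y =>
      intro hadj
      have hxy : H.Reachable x y := SimpleGraph.Adj.reachable hadj
      exact (hcover x).imp (fun h => by simp [h, h.trans hxy])
        fun h => by simp [h, h.trans hxy]
  have hsubG : ∀ {S : Finset (Sym2 V)}, S ⊆ X ∪ Y → (S : Set (Sym2 V)) ⊆ G.edgeSet :=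
    fun hS e he => (hHe ▸ (hmemXY e).1 (hS he)).1
  have hcXY : ∀ f ∈ X ∪ Y, 0 < c f := fun f hf => hc f (hsubG subset_rfl hf)
  have hXs : X ⊆ X ∪ Y := Finset.subset_union_left
  have hYs : Y ⊆ X ∪ Y := Finset.subset_union_right
  have hobjA : ∀ M : List (Sym2 V), M.toFinset = X → treeObj c w {v | H.Reachable a v} M =
      scheduleCost c (unjoinedWeight w {v | H.Reachable a v}) ∅ M := fun M hM =>
    treeObj_eq_scheduleCost c w _ M fun q hq => joins_within_component subset_rfl
      (fun e he h => List.mem_toFinset.1 (hM ▸ (hmemA e).2 ⟨he, h⟩)) hq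
      (SimpleGraph.Reachable.joins hq)
  have hobjB : ∀ M : List (Sym2 V), M.toFinset = Y → treeObj c w {v | H.Reachable b v} M =
      scheduleCost c (unjoinedWeight w {v | H.Reachable b v}) ∅ M := fun M hM =>
    treeObj_eq_scheduleCost c w _ M fun q hq => joins_within_component subset_rfl
      (fun e he h => List.mem_toFinset.1 (hM ▸ (hmemB e).2 ⟨he, h⟩)) hq
      (SimpleGraph.Reachable.joins hq)
  set UA := unjoinedWeight w {v | H.Reachable a v} with hUA
  set UB := unjoinedWeight w {v | H.Reachable b v} with hUB
  have hordering : ∀ K : List (Sym2 V),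
      IsOrdering (K ++ [s(a, b)]) G.edgeSet ↔ K.Nodup ∧ K.toFinset = X ∪ Y := by
    intro K
    have hab' : s(a, b) ∈ G.edgeSet := hab
    simp only [IsOrdering, List.nodup_append, List.mem_append, List.mem_singleton,
      Finset.ext_iff, hmemXY, hHe, List.mem_toFinset, Set.mem_sdiff, Set.mem_singleton_iff]
    constructor
    · rintro ⟨⟨h1, -, h3⟩, h4⟩
      refine ⟨h1, fun e => ⟨fun he => ⟨(h4 e).1 (Or.inl he), h3 e he _ rfl⟩, fun he => ?_⟩⟩
      exact ((h4 e).2 he.1).resolve_right he.2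
    · rintro ⟨h1, h2⟩
      refine ⟨⟨h1, by simp, ?_⟩, fun e => ?_⟩
      · rintro e he _ rfl
        exact ((h2 e).1 he).2
      · rw [h2 e]
        by_cases he : e = s(a, b)
        · simp [he, hab]
        · simp [he]
  obtain ⟨C, hobj⟩ : ∃ C, ∀ K : List (Sym2 V), K.Nodup → K.toFinset = X ∪ Y →
      treeObj c w Set.univ (K ++ [s(a, b)]) =
        scheduleCost c (fun S => UA (S ∩ X) + UB (S ∩ Y)) ∅ K + C := by
    classical
    refine ⟨(∑ q : Sym2 V, if (∀ x ∈ q, H.Reachable a x) ∨ (∀ x ∈ q, H.Reachable b x)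
      then 0 else w q) * ∑ f ∈ X ∪ Y, c f +
        c s(a, b) * unjoinedWeight w Set.univ (X ∪ Y), fun K hK hKXY => ?_⟩
    have hfull : {e | e ∈ K ++ [s(a, b)]} = G.edgeSet :=
      Set.ext ((hordering K).2 ⟨hK, hKXY⟩).2
    rw [treeObj_eq_scheduleCost c w _ _ fun q _ => hfull ▸
      SimpleGraph.Reachable.joins (a := a) fun x _ => hT.connected.preconnected a x,
      scheduleCost_append, scheduleCost_congr (X ∪ Y) (fun Q hQ => unjoinedWeight_univ_eq
        (PA := Q ∩ X) (PB := Q ∩ Y) hnot hcover w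
        (fun e he => (hmemXY e).1 (hQ he)) (fun e => ?_) fun e => ?_) ∅ K (by simp [hKXY]),
      scheduleCost_add, scheduleCost_const, ← hKXY, List.sum_toFinset _ hK]
    · simp [scheduleCost, hUA, hUB]
      ring_nf
    · rw [Finset.mem_inter, hmemA]
      exact ⟨fun h => ⟨h.1, h.2.2⟩, fun h => ⟨h.1, (hmemXY e).1 (hQ h.1), h.2⟩⟩
    · rw [Finset.mem_inter, hmemB]
      exact ⟨fun h => ⟨h.1, h.2.2⟩, fun h => ⟨h.1, (hmemXY e).1 (hQ h.1), h.2⟩⟩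
  obtain ⟨N, hN, hmin⟩ := Finset.exists_min_image (X ∪ Y).toList.permutations.toFinset
    (scheduleCost c (fun S => UA (S ∩ X) + UB (S ∩ Y)) ∅) ⟨(X ∪ Y).toList, by simp⟩
  simp only [List.mem_toFinset, List.mem_permutations] at hN hmin
  have hNn : N.Nodup := hN.nodup_iff.2 (Finset.nodup_toList _)
  have hNXY : N.toFinset = X ∪ Y := by rw [List.toFinset_eq_of_perm _ _ hN, Finset.toList_toFinset]
  obtain ⟨N₁, hp₁, hX₁, -, hle₁⟩ := exists_merge_le (U := UA) hXY hcXY UB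
    (fun P hP Q hQ => unjoinedWeight_submodular hT.isAcyclic hw _ (hsubG (hP.trans hXs))
      (hsubG (hQ.trans hXs))) hL'.1 hX.symm
    (fun M hM hMX => by
      rw [← hobjA L' rfl, ← hobjA M hMX]
      exact hopt' M ⟨hM, fun e => by rw [← hL'.2, ← List.mem_toFinset, hMX, hX, List.mem_toFinset]⟩)
    hNn hNXY
  obtain ⟨N₂, hp₂, hY₂, hX₂, hle₂⟩ := exists_merge_le (U := UB) hXY.symm
    (fun f hf => hcXY f (by rwa [Finset.union_comm])) UA
    (fun P hP Q hQ => unjoinedWeight_submodular hT.isAcyclic hw _ (hsubG (hP.trans hYs))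
      (hsubG (hQ.trans hYs))) hL''.1 hY.symm
    (fun M hM hMY => by
      rw [← hobjB L'' rfl, ← hobjB M hMY]
      exact hopt'' M
        ⟨hM, fun e => by rw [← hL''.2, ← List.mem_toFinset, hMY, hY, List.mem_toFinset]⟩)
    (hp₁.nodup_iff.2 hNn)
    ((List.toFinset_eq_of_perm _ _ hp₁).trans (hNXY.trans (Finset.union_comm X Y)))
  have hcomm : (fun S => UB (S ∩ Y) + UA (S ∩ X)) = fun S => UA (S ∩ X) + UB (S ∩ Y) :=
    funext fun S => add_comm _ _
  rw [hcomm] at hle₂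
  have hn₂ : N₂.Nodup := (hp₂.trans hp₁).nodup_iff.2 hNn
  have hs₂ : N₂.toFinset = X ∪ Y := (List.toFinset_eq_of_perm _ _ (hp₂.trans hp₁)).trans hNXY
  have hL'N₂ : L'.Sublist N₂ := by
    have : N₁.filter (· ∉ Y) = N₁.filter (· ∈ X) := by
      refine List.filter_congr fun f hf => ?_
      have hf' : f ∈ X ∪ Y := by
        rw [← hNXY, ← List.toFinset_eq_of_perm _ _ hp₁]; exact List.mem_toFinset.2 hf
      have : f ∈ X → f ∉ Y := fun h => Finset.disjoint_left.1 hXY h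
      rw [Finset.mem_union] at hf'
      simp only [decide_eq_decide]
      tauto
    rw [← hX₁, ← this, ← hX₂]
    exact List.filter_sublist
  refine ⟨N₂ ++ [s(a, b)], (hordering N₂).2 ⟨hn₂, hs₂⟩, by simp, fun M hM hlast => ?_,
    hL'N₂.trans (List.sublist_append_left _ _), ?_⟩
  · obtain ⟨K, rfl⟩ := List.getLast?_eq_some_iff.1 hlast
    obtain ⟨hK, hKXY⟩ := (hordering K).1 hM
    rw [hobj N₂ hn₂ hs₂, hobj K hK hKXY]
    have := hmin K (List.perm_of_nodup_nodup_toFinset_eq hK (Finset.nodup_toList _)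
      (by rw [hKXY, Finset.toList_toFinset]))
    linarith
  · rw [← hY₂]
    exact List.filter_sublist.trans (List.sublist_append_left _ _)
end
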